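/- arXiv:2308.11987 — 2 statements merged into one kernel-verified Lean document; each statement's English description precedes it below -/
import Mathlib

section
/- There is an absolute constant c > 0 such that for all real x ≥ 1, ∑_{n ≤ x} Δ(n) ≥ c · x · ∏_{p < x^{1/10}}(1 + 1/p)^{-1} · ∑_{n ∈ S_{<x^{1/10}}} Δ(n)/n. -/
open Filter Topology
open scoped Classical

noncomputable def LLog (x : ℝ) : ℝ := max 1 (Real.log x)
noncomputable def LLog2 (x : ℝ) : ℝ := LLog (LLog x)
noncomputable def LLog3 (x : ℝ) : ℝ := LLog (LLog2 x)

/-- `Δ^{(v)}(n)`: the maximal number of divisors of `n` in an interval `(e^u, e^{u+v}]`. -/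
noncomputable def DeltaV (v : ℝ) (n : ℕ) : ℕ :=
  ⨆ u : ℝ, (n.divisors.filter fun d => Real.exp u < (d : ℝ) ∧ (d : ℝ) ≤ Real.exp (u + v)).card

/-- The Erdős–Hooley Delta function. -/
noncomputable def Delta (n : ℕ) : ℕ := DeltaV 1 n

/-- `S_{[y,x)}`: squarefree positive integers all of whose prime factors `p` satisfy `y ≤ p < x`. -/
def Sset (y x : ℝ) : Set ℕ :=
  {n | 0 < n ∧ Squarefree n ∧ ∀ p ∈ n.primeFactors, y ≤ (p : ℝ) ∧ (p : ℝ) < x}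

/-- `∏_{y ≤ p < x} (1 + 1/p)⁻¹`, product over primes. -/
noncomputable def primeProd (y x : ℝ) : ℝ :=
  ∏ᶠ p ∈ {p : ℕ | p.Prime ∧ y ≤ (p : ℝ) ∧ (p : ℝ) < x}, ((1 : ℝ) + 1 / p)⁻¹

/-- number of distinct prime factors -/
def omegaN (n : ℕ) : ℕ := n.primeFactors.card

/-- number of divisors -/
def tauN (n : ℕ) : ℕ := n.divisors.card

/-- `n_{<y}`: the largest divisor of `n` (squarefree) composed of primes `< y`. -/
noncomputable def nsmall (n : ℕ) (y : ℝ) : ℕ :=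
  ∏ p ∈ n.primeFactors.filter (fun p : ℕ => (p : ℝ) < y), p

def Yset (α x : ℝ) : Set ℝ :=
  {y | 0 < y ∧ |LLog2 y - α * LLog2 x| ≤ Real.sqrt (LLog2 x) ∧ ∃ m : ℤ, LLog2 y = m * Real.log 2}

def Uset (α x : ℝ) : Set ℤ :=
  {u | |(u : ℝ) - (Real.log 4 - 1) / Real.log 2 * (α * LLog2 x)| ≤ Real.sqrt (LLog2 x)}

noncomputable def Qfun (t : ℝ) : ℝ := t * Real.log t - t + 1

lemma DeltaV_eq (v : ℝ) (n : ℕ) : DeltaV v n = ⨆ u : ℝ,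
    (n.divisors.filter fun d : ℕ => Real.exp u < (d : ℝ) ∧ (d : ℝ) ≤ Real.exp (u + v)).card := by
  unfold DeltaV
  congr 1
  ext u
  symm
  refine Finset.card_bij (fun d _ => (d : ℝ)) ?_ ?_ ?_
  · intro d hd
    rw [Finset.mem_filter] at hd ⊢
    refine ⟨?_, hd.2⟩
    simp only [Finset.bind_def, Finset.pure_def, Finset.mem_sup, Finset.mem_singleton]
    exact ⟨d, hd.1, rfl⟩
  · intro a _ b _ h
    exact_mod_cast h
  · intro b hb
    rw [Finset.mem_filter] at hb
    obtain ⟨h1, h2⟩ := hb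
    simp only [Finset.bind_def, Finset.pure_def, Finset.mem_sup, Finset.mem_singleton] at h1
    obtain ⟨d, hd, rfl⟩ := h1
    exact ⟨d, Finset.mem_filter.2 ⟨hd, h2⟩, rfl⟩

lemma D_bdd (v : ℝ) (n : ℕ) : BddAbove (Set.range fun u : ℝ =>
    (n.divisors.filter fun d : ℕ => Real.exp u < (d : ℝ) ∧ (d : ℝ) ≤ Real.exp (u + v)).card) := by
  refine ⟨n.divisors.card, ?_⟩
  rintro _ ⟨u, rfl⟩
  exact Finset.card_filter_le _ _

lemma D_mono {n m : ℕ} (h : n ∣ m) (hm : m ≠ 0) : Delta n ≤ Delta m := by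
  unfold Delta
  rw [DeltaV_eq, DeltaV_eq]
  refine ciSup_mono (D_bdd 1 m) fun u => ?_
  exact Finset.card_le_card (Finset.filter_subset_filter _ (Nat.divisors_subset_of_dvd hm h))

lemma D_mul_prime {m p : ℕ} (hp : p.Prime) : Delta (p * m) ≤ 2 * Delta m := by
  unfold Delta
  rw [DeltaV_eq 1 (p * m)]
  refine ciSup_le fun u => ?_
  have key : ∀ u : ℝ, (m.divisors.filter fun d : ℕ => Real.exp u < (d : ℝ) ∧ (d : ℝ) ≤ Real.exp (u + 1)).card ≤ DeltaV 1 m :=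
    fun u => by rw [DeltaV_eq]; exact le_ciSup (D_bdd 1 m) u
  have h1 := key u
  have h2 := key (u - Real.log p)
  have hp0 : (0:ℝ) < p := by exact_mod_cast hp.pos
  have hsub : ((p * m).divisors.filter fun d : ℕ => Real.exp u < (d : ℝ) ∧ (d : ℝ) ≤ Real.exp (u + 1)) ⊆
      (m.divisors.filter fun d : ℕ => Real.exp u < (d : ℝ) ∧ (d : ℝ) ≤ Real.exp (u + 1)) ∪
      ((m.divisors.filter fun d : ℕ => Real.exp (u - Real.log p) < (d : ℝ) ∧ (d : ℝ) ≤ Real.exp (u - Real.log p + 1)).image (p * ·)) := by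
    intro d hd
    rw [Finset.mem_filter, Nat.mem_divisors] at hd
    obtain ⟨⟨hd, hne⟩, hd1, hd2⟩ := hd
    have hm0 : m ≠ 0 := by rintro rfl; simp at hne
    rw [Finset.mem_union, Finset.mem_filter, Finset.mem_image]
    by_cases hpd : p ∣ d
    · right
      obtain ⟨e, rfl⟩ := hpd
      refine ⟨e, ?_, rfl⟩
      rw [Finset.mem_filter, Nat.mem_divisors]
      refine ⟨⟨Nat.dvd_of_mul_dvd_mul_left hp.pos hd, hm0⟩, ?_, ?_⟩
      · rw [Real.exp_sub, Real.exp_log hp0, div_lt_iff₀ hp0]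
        push_cast at hd1; linarith
      · rw [show u - Real.log p + 1 = (u + 1) - Real.log p by ring, Real.exp_sub, Real.exp_log hp0, le_div_iff₀ hp0]
        push_cast at hd2; linarith
    · left
      refine ⟨Nat.mem_divisors.2 ⟨?_, hm0⟩, hd1, hd2⟩
      exact Nat.Coprime.dvd_of_dvd_mul_left ((hp.coprime_iff_not_dvd.2 hpd).symm) hd
  calc _ ≤ _ := Finset.card_le_card hsub
    _ ≤ _ := Finset.card_union_le _ _
    _ ≤ DeltaV 1 m + DeltaV 1 m := add_le_add h1 (Finset.card_image_le.trans h2)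
    _ = _ := by ring

lemma D_one : 1 ≤ Delta 1 := by
  unfold Delta
  rw [DeltaV_eq]
  refine le_trans ?_ (le_ciSup (D_bdd 1 1) (-1))
  rw [Finset.one_le_card]
  exact ⟨1, by simp⟩

/-- product of primes below N -/
def MM (N : ℕ) : ℕ := ∏ p ∈ N.primesBelow, p

lemma MM_ne (N : ℕ) : MM N ≠ 0 :=
  Finset.prod_ne_zero_iff.2 fun _ hp => (Nat.prime_of_mem_primesBelow hp).ne_zero

lemma dvd_MM {N n : ℕ} : n ∣ MM N ↔ Squarefree n ∧ ∀ p ∈ n.primeFactors, p < N := by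
  constructor
  · intro h
    have hpf : (MM N).primeFactors = N.primesBelow :=
      Nat.primeFactors_prod (fun p hp => Nat.prime_of_mem_primesBelow hp)
    refine ⟨Squarefree.squarefree_of_dvd h ?_, fun p hp => ?_⟩
    · unfold MM
      refine Finset.squarefree_prod_of_pairwise_isCoprime ?_ ?_
      · intro p hp q hq hpq
        exact Nat.coprime_iff_isRelPrime.1 ((Nat.coprime_primes (Nat.prime_of_mem_primesBelow hp) (Nat.prime_of_mem_primesBelow hq)).2 hpq)
      · intro p hp
        exact (Nat.prime_of_mem_primesBelow hp).prime.squarefree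
    · have := Nat.primeFactors_mono h (MM_ne N) hp
      rw [hpf] at this
      exact Nat.lt_of_mem_primesBelow this
  · rintro ⟨h1, h2⟩
    rw [← Nat.prod_primeFactors_of_squarefree h1]
    refine Finset.prod_dvd_prod_of_subset _ _ _ fun p hp => ?_
    rw [Nat.mem_primesBelow]
    exact ⟨h2 p hp, Nat.prime_of_mem_primeFactors hp⟩

lemma Sset_eq (y : ℝ) : Sset 1 y = ((MM ⌈y⌉₊).divisors : Set ℕ) := by
  ext n
  simp only [Sset, Set.mem_ofPred_eq, Finset.mem_coe, Nat.mem_divisors, dvd_MM, Nat.lt_ceil]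
  constructor
  · rintro ⟨h0, h1, h2⟩
    exact ⟨⟨h1, fun p hp => (h2 p hp).2⟩, MM_ne _⟩
  · rintro ⟨⟨h1, h2⟩, -⟩
    exact ⟨Nat.pos_of_ne_zero h1.ne_zero, h1, fun p hp =>
      ⟨by exact_mod_cast (Nat.prime_of_mem_primeFactors hp).one_le, h2 p hp⟩⟩

lemma primeProd_eq (y : ℝ) : primeProd 1 y = ∏ p ∈ (⌈y⌉₊).primesBelow, ((1:ℝ) + 1 / p)⁻¹ := by
  unfold primeProd
  rw [← finprod_mem_coe_finset]
  have : {p : ℕ | p.Prime ∧ (1:ℝ) ≤ (p : ℝ) ∧ (p : ℝ) < y} = (((⌈y⌉₊).primesBelow : Finset ℕ) : Set ℕ) := by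
    ext p
    simp only [Set.mem_ofPred_eq, Finset.mem_coe, Nat.mem_primesBelow, Nat.lt_ceil]
    exact ⟨fun h => ⟨h.2.2, h.1⟩, fun h => ⟨h.2, by exact_mod_cast h.2.one_le, h.1⟩⟩
  rw [this]

noncomputable def WW (N : ℕ) : ℝ := ∑ n ∈ (MM N).divisors, (Delta n : ℝ) / n

lemma WW_nonneg (N : ℕ) : 0 ≤ WW N := Finset.sum_nonneg fun _ _ => by positivity

lemma WW_mono {N N' : ℕ} (h : N ≤ N') : WW N ≤ WW N' := by
  refine Finset.sum_le_sum_of_subset_of_nonneg ?_ fun _ _ _ => by positivity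
  refine Nat.divisors_subset_of_dvd (MM_ne _) ?_
  have := (dvd_MM (N := N) (n := MM N)).1 dvd_rfl
  exact dvd_MM.2 ⟨this.1, fun p hp => (this.2 p hp).trans_le h⟩

/-- Mertens upper bound -/
lemma mertens (N : ℕ) (hN : 0 < N) :
    ∑ p ∈ N.primesBelow, Real.log p / p ≤ Real.log N + Real.log 4 := by
  have hN' : (0:ℝ) < N := by exact_mod_cast hN
  have h1 : ∑ p ∈ N.primesBelow, Real.log p * ((N / p : ℕ) : ℝ) ≤ N * Real.log N := by
    calc ∑ p ∈ N.primesBelow, Real.log p * ((N / p : ℕ) : ℝ)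
        = ∑ p ∈ N.primesBelow, ∑ e ∈ Finset.range N, if p ∣ e + 1 then Real.log p else 0 := by
          refine Finset.sum_congr rfl fun p _ => ?_
          rw [← Finset.sum_filter, Finset.sum_const, Nat.card_multiples, nsmul_eq_mul, mul_comm]
      _ = ∑ e ∈ Finset.range N, ∑ p ∈ N.primesBelow, if p ∣ e + 1 then Real.log p else 0 := Finset.sum_comm
      _ ≤ ∑ e ∈ Finset.range N, Real.log N := by
          refine Finset.sum_le_sum fun e he => ?_
          rw [← Finset.sum_filter]
          calc ∑ p ∈ N.primesBelow with p ∣ e + 1, Real.log p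
              ≤ ∑ p ∈ (e+1).primeFactors, Real.log p := by
                refine Finset.sum_le_sum_of_subset_of_nonneg ?_ fun p _ _ => Real.log_natCast_nonneg p
                intro p hp
                rw [Finset.mem_filter] at hp
                exact Nat.mem_primeFactors.2 ⟨Nat.prime_of_mem_primesBelow hp.1, hp.2, by simp⟩
            _ = Real.log ((∏ p ∈ (e+1).primeFactors, p : ℕ) : ℝ) := by
                rw [Nat.cast_prod, Real.log_prod]
                intro p hp
                exact_mod_cast (Nat.prime_of_mem_primeFactors hp).ne_zero
            _ ≤ Real.log N := by
                refine Real.log_le_log ?_ ?_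
                · exact_mod_cast Finset.prod_pos fun p hp => (Nat.prime_of_mem_primeFactors hp).pos
                · have := Nat.le_of_dvd (by simp) (Nat.prod_primeFactors_dvd (e+1))
                  have := Finset.mem_range.1 he
                  exact_mod_cast (by omega)
      _ = _ := by simp
  have h2 : ∑ p ∈ N.primesBelow, Real.log p ≤ Real.log 4 * N := by
    refine le_trans ?_ (Chebyshev.theta_le_log4_mul_x hN'.le)
    rw [Chebyshev.theta_eq_sum_Icc]
    refine Finset.sum_le_sum_of_subset_of_nonneg ?_ fun p _ _ => Real.log_natCast_nonneg p
    intro p hp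
    rw [Nat.mem_primesBelow] at hp
    simp [hp.2, hp.1.le]
  have h3 : N * ∑ p ∈ N.primesBelow, Real.log p / p ≤
      ∑ p ∈ N.primesBelow, Real.log p * ((N / p : ℕ) : ℝ) + ∑ p ∈ N.primesBelow, Real.log p := by
    rw [Finset.mul_sum, ← Finset.sum_add_distrib]
    refine Finset.sum_le_sum fun p hp => ?_
    have : (N:ℝ) / p ≤ ((N / p : ℕ) : ℝ) + 1 := by
      rw [← Nat.floor_div_eq_div (K := ℝ)]
      exact (Nat.lt_floor_add_one _).le
    have := mul_le_mul_of_nonneg_left this (Real.log_natCast_nonneg p)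
    calc _ = Real.log p * ((N:ℝ) / p) := by ring
      _ ≤ _ := this
      _ = _ := by ring
  have h4 : (N:ℝ) * ∑ p ∈ N.primesBelow, Real.log p / p ≤ N * (Real.log N + Real.log 4) := by
    linarith
  exact le_of_mul_le_mul_left h4 hN'

lemma tail_log (N : ℕ) (hN : 0 < N) :
    ∑ n ∈ (MM N).divisors, (Delta n : ℝ) / n * Real.log n ≤ 2 * (Real.log N + Real.log 4) * WW N := by
  calc ∑ n ∈ (MM N).divisors, (Delta n : ℝ) / n * Real.log n
      = ∑ n ∈ (MM N).divisors, ∑ p ∈ N.primesBelow, if p ∣ n then (Delta n : ℝ) / n * Real.log p else 0 := by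
        refine Finset.sum_congr rfl fun n hn => ?_
        obtain ⟨hs, hl⟩ := dvd_MM.1 (Nat.dvd_of_mem_divisors hn)
        rw [← Finset.sum_filter, ← Finset.mul_sum]
        congr 1
        have : (N.primesBelow.filter (· ∣ n)) = n.primeFactors := by
          ext p
          rw [Finset.mem_filter, Nat.mem_primesBelow]
          constructor
          · rintro ⟨⟨_, h⟩, h'⟩
            exact Nat.mem_primeFactors.2 ⟨h, h', hs.ne_zero⟩
          · intro h
            exact ⟨⟨hl p h, Nat.prime_of_mem_primeFactors h⟩, Nat.dvd_of_mem_primeFactors h⟩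
        rw [this]
        conv_lhs => rw [← Nat.prod_primeFactors_of_squarefree hs]
        rw [Nat.cast_prod, Real.log_prod]
        intro p hp
        exact_mod_cast (Nat.prime_of_mem_primeFactors hp).ne_zero
    _ = ∑ p ∈ N.primesBelow, ∑ n ∈ (MM N).divisors, if p ∣ n then (Delta n : ℝ) / n * Real.log p else 0 := Finset.sum_comm
    _ ≤ ∑ p ∈ N.primesBelow, Real.log p / p * (2 * WW N) := by
        refine Finset.sum_le_sum fun p hp => ?_
        have hpp := Nat.prime_of_mem_primesBelow hp
        have hp0 : (0:ℝ) < p := by exact_mod_cast hpp.pos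
        rw [← Finset.sum_filter]
        unfold WW
        rw [Finset.mul_sum, Finset.mul_sum]
        calc ∑ n ∈ (MM N).divisors with p ∣ n, (Delta n : ℝ) / n * Real.log p
            ≤ ∑ n ∈ (MM N).divisors with p ∣ n, Real.log p / p * (2 * ((Delta (n / p) : ℝ) / ((n / p : ℕ) : ℝ))) := by
              refine Finset.sum_le_sum fun n hn => ?_
              rw [Finset.mem_filter] at hn
              obtain ⟨m, rfl⟩ := hn.2
              rw [Nat.mul_div_cancel_left _ hpp.pos]
              have h1 : (Delta (p * m) : ℝ) ≤ 2 * Delta m := by exact_mod_cast D_mul_prime hpp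
              have hm : (0:ℝ) < m := by
                have : p * m ≠ 0 := (Nat.pos_of_mem_divisors hn.1).ne'
                exact_mod_cast Nat.pos_of_ne_zero (by rintro rfl; simp at this)
              have hl := Real.log_natCast_nonneg p
              calc (Delta (p * m) : ℝ) / ((p * m : ℕ):ℝ) * Real.log p ≤ (2 * Delta m) / ((p * m : ℕ):ℝ) * Real.log p := by gcongr
                _ = _ := by push_cast; field_simp
          _ = ∑ n ∈ ((MM N).divisors.filter (p ∣ ·)).image (· / p), Real.log p / p * (2 * ((Delta n : ℝ) / n)) := by
              rw [Finset.sum_image]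
              intro a ha b hb hab
              obtain ⟨a', rfl⟩ := (Finset.mem_filter.1 ha).2
              obtain ⟨b', rfl⟩ := (Finset.mem_filter.1 hb).2
              simp only [Nat.mul_div_cancel_left _ hpp.pos] at hab
              rw [hab]
          _ ≤ _ := by
              refine Finset.sum_le_sum_of_subset_of_nonneg ?_ fun n _ _ => ?_
              · intro m hm
                obtain ⟨n, hn, rfl⟩ := Finset.mem_image.1 hm
                rw [Finset.mem_filter, Nat.mem_divisors] at hn
                exact Nat.mem_divisors.2 ⟨(Nat.div_dvd_of_dvd hn.2).trans hn.1.1, MM_ne N⟩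
              · have hl := Real.log_natCast_nonneg p
                positivity
    _ = (∑ p ∈ N.primesBelow, Real.log p / p) * (2 * WW N) := by rw [Finset.sum_mul]
    _ ≤ (Real.log N + Real.log 4) * (2 * WW N) :=
        mul_le_mul_of_nonneg_right (mertens N hN) (by have := WW_nonneg N; positivity)
    _ = _ := by ring

lemma sum_inv_sq (N : ℕ) : ∑ b ∈ Finset.Ico 1 N, (1:ℝ) / (b:ℝ)^2 ≤ 2 := by
  have : ∀ N : ℕ, ∑ b ∈ Finset.Ico 1 (N+1), (1:ℝ) / (b:ℝ)^2 ≤ 2 - 1 / N := by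
    intro N
    induction N with
    | zero => simp
    | succ k ih =>
      rw [Finset.sum_Ico_succ_top (by omega)]
      rcases Nat.eq_zero_or_pos k with rfl | hk
      · norm_num
      · have hk' : (0:ℝ) < k := by exact_mod_cast hk
        have : (1:ℝ) / ((k+1 : ℕ):ℝ)^2 ≤ 1 / k - 1 / ((k+1:ℕ):ℝ) := by
          push_cast
          rw [div_sub_div _ _ (by positivity) (by positivity), div_le_div_iff₀ (by positivity) (by positivity)]
          nlinarith
        linarith
  rcases N with _ | N
  · simp
  · refine (this N).trans ?_
    have : (0:ℝ) ≤ 1 / N := by positivity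
    linarith

lemma prod_lower (N : ℕ) (hN : 0 < N) :
    Real.log N ≤ 2 * ∏ p ∈ N.primesBelow, ((1:ℝ) + 1 / p) := by
  have h1 : ∑ a ∈ (MM N).divisors, (1:ℝ) / a ≤ ∏ p ∈ N.primesBelow, ((1:ℝ) + 1 / p) := by
    rw [Finset.prod_one_add]
    calc ∑ a ∈ (MM N).divisors, (1:ℝ) / a
        = ∑ a ∈ (MM N).divisors, ∏ p ∈ a.primeFactors, (1:ℝ) / p := by
          refine Finset.sum_congr rfl fun a ha => ?_
          obtain ⟨hs, hl⟩ := dvd_MM.1 (Nat.dvd_of_mem_divisors ha)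
          conv_lhs => rw [← Nat.prod_primeFactors_of_squarefree hs]
          simp
      _ = ∑ t ∈ (MM N).divisors.image Nat.primeFactors, ∏ p ∈ t, (1:ℝ) / p := by
          rw [Finset.sum_image]
          intro a ha b hb hab
          have ha' := (dvd_MM.1 (Nat.dvd_of_mem_divisors ha)).1
          have hb' := (dvd_MM.1 (Nat.dvd_of_mem_divisors hb)).1
          rw [← Nat.prod_primeFactors_of_squarefree ha', ← Nat.prod_primeFactors_of_squarefree hb', hab]
      _ ≤ _ := by
          refine Finset.sum_le_sum_of_subset_of_nonneg ?_ fun t _ _ => by positivity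
          intro t ht
          obtain ⟨a, ha, rfl⟩ := Finset.mem_image.1 ht
          obtain ⟨hs, hl⟩ := dvd_MM.1 (Nat.dvd_of_mem_divisors ha)
          rw [Finset.mem_powerset]
          intro p hp
          exact Nat.mem_primesBelow.2 ⟨hl p hp, Nat.prime_of_mem_primeFactors hp⟩
  have h2 : Real.log N ≤ ∑ n ∈ Finset.Ico 1 N, (1:ℝ) / n := by
    obtain ⟨k, rfl⟩ : ∃ k, N = k + 1 := ⟨N - 1, by omega⟩
    refine (log_add_one_le_harmonic k).trans_eq ?_
    rw [harmonic_eq_sum_Icc]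
    push_cast
    refine Finset.sum_congr ?_ fun _ _ => by simp
    ext; simp
  have h3 : ∑ n ∈ Finset.Ico 1 N, (1:ℝ) / n ≤
      (∑ b ∈ Finset.Ico 1 N, (1:ℝ) / (b:ℝ)^2) * ∑ a ∈ (MM N).divisors, (1:ℝ) / a := by
    rw [Finset.sum_mul_sum, ← Finset.sum_product']
    calc ∑ n ∈ Finset.Ico 1 N, (1:ℝ) / n
        ≤ ∑ n ∈ (Finset.Ico 1 N ×ˢ (MM N).divisors).image (fun z : ℕ × ℕ => z.1 ^ 2 * z.2), (1:ℝ) / n := by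
          refine Finset.sum_le_sum_of_subset_of_nonneg ?_ fun _ _ _ => by positivity
          intro n hn
          rw [Finset.mem_Ico] at hn
          obtain ⟨a, b, ha, hb, hab, hs⟩ := Nat.sq_mul_squarefree_of_pos hn.1
          refine Finset.mem_image.2 ⟨(b, a), ?_, hab⟩
          rw [Finset.mem_product, Finset.mem_Ico, Nat.mem_divisors, dvd_MM]
          have hbn : b ≤ n := by
            rw [← hab]; nlinarith [Nat.mul_le_mul hb ha]
          have han : a ≤ n := Nat.le_of_dvd hn.1 ⟨b^2, by rw [← hab]; ring⟩
          refine ⟨⟨hb, by simp only; omega⟩, ⟨hs, fun p hp => ?_⟩, MM_ne N⟩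
          have := Nat.le_of_mem_primeFactors hp
          simp only at this
          omega
      _ ≤ ∑ z ∈ Finset.Ico 1 N ×ˢ (MM N).divisors, (1:ℝ) / ((z.1 ^ 2 * z.2 : ℕ) : ℝ) :=
          Finset.sum_image_le_of_nonneg (g := fun z : ℕ × ℕ => z.1 ^ 2 * z.2) (f := fun n : ℕ => (1:ℝ) / n) (fun _ _ => by positivity)
      _ = _ := by
          refine Finset.sum_congr rfl fun z _ => ?_
          push_cast
          rw [div_mul_div_comm, one_mul]
  have h4 : (0:ℝ) ≤ ∑ a ∈ (MM N).divisors, (1:ℝ) / a := Finset.sum_nonneg fun _ _ => by positivity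
  have := mul_le_mul_of_nonneg_right (sum_inv_sq N) h4
  linarith

/-- combinatorial injection -/
lemma inject (N X : ℕ) (T : Finset ℕ) (hT : T ⊆ (MM N).divisors) :
    ∑ n ∈ T, (Delta n : ℝ) * (((Finset.Icc N (X / n)).filter Nat.Prime).card : ℝ) ≤
      ∑ n ∈ Finset.Icc 1 X, (Delta n : ℝ) := by
  calc ∑ n ∈ T, (Delta n : ℝ) * (((Finset.Icc N (X / n)).filter Nat.Prime).card : ℝ)
      = ∑ n ∈ T, ∑ q ∈ (Finset.Icc N (X / n)).filter Nat.Prime, (Delta n : ℝ) := by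
        refine Finset.sum_congr rfl fun n _ => ?_
        rw [Finset.sum_const, nsmul_eq_mul, mul_comm]
    _ = ∑ z ∈ T.sigma (fun n => (Finset.Icc N (X / n)).filter Nat.Prime), (Delta z.1 : ℝ) := by
        rw [Finset.sum_sigma]
    _ ≤ ∑ z ∈ T.sigma (fun n => (Finset.Icc N (X / n)).filter Nat.Prime), (Delta (z.1 * z.2) : ℝ) := by
        refine Finset.sum_le_sum fun z hz => ?_
        rw [Finset.mem_sigma, Finset.mem_filter] at hz
        have h1 := Nat.pos_of_mem_divisors (hT hz.1)
        have h2 := hz.2.2.pos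
        exact_mod_cast D_mono (Dvd.intro _ rfl) (by positivity)
    _ = ∑ n ∈ (T.sigma (fun n => (Finset.Icc N (X / n)).filter Nat.Prime)).image (fun z => z.1 * z.2), (Delta n : ℝ) := by
        rw [Finset.sum_image]
        rintro ⟨a, q⟩ ha ⟨b, r⟩ hb hab
        simp only [Finset.coe_sigma, Set.mem_sigma_iff, Finset.mem_coe, Finset.mem_filter, Finset.mem_Icc] at ha hb hab
        have hqr : q = r := by
          by_contra hne
          have h1 : q ∣ b * r := hab ▸ Dvd.intro_left _ rfl
          have h2 : q ∣ b := by
            rcases ha.2.2.dvd_mul.1 h1 with h | h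
            · exact h
            · exact absurd ((Nat.prime_dvd_prime_iff_eq ha.2.2 hb.2.2).1 h) hne
          have hb' := Nat.mem_divisors.1 (hT hb.1)
          have := (dvd_MM.1 hb'.1).2 q (Nat.mem_primeFactors.2 ⟨ha.2.2, h2, (Nat.pos_of_mem_divisors (hT hb.1)).ne'⟩)
          omega
        subst hqr
        have := Nat.eq_of_mul_eq_mul_right ha.2.2.pos hab
        subst this
        rfl
    _ ≤ _ := by
        refine Finset.sum_le_sum_of_subset_of_nonneg ?_ fun _ _ _ => by positivity
        intro m hm
        obtain ⟨z, hz, rfl⟩ := Finset.mem_image.1 hm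
        rw [Finset.mem_sigma, Finset.mem_filter, Finset.mem_Icc] at hz
        have h1 := Nat.pos_of_mem_divisors (hT hz.1)
        have h2 := hz.2.2.pos
        rw [Finset.mem_Icc]
        refine ⟨Nat.mul_pos h1 h2, ?_⟩
        have := (Nat.le_div_iff_mul_le h1).1 hz.2.1.2
        linarith

lemma prime_count (N : ℕ) (z L y : ℝ) (hy : 4096 ≤ y) (hL : L = Real.log y) (hN : (N:ℝ) ≤ 2 * y)
    (hz : y ^ 5 ≤ z) (hz' : z ≤ y ^ 10) :
    z / (40 * L) ≤ (((Finset.Icc N ⌊z⌋₊).filter Nat.Prime).card : ℝ) := by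
  have hL0 : 0 < L := hL ▸ Real.log_pos (by linarith)
  have hLy : L ≤ y := hL ▸ (Real.log_le_self (by linarith))
  have hy2 : y ≤ y ^ 5 := le_self_pow₀ (by linarith) (by norm_num)
  have hz0 : 4096 ≤ z := by linarith
  have hlz : Real.log z ≤ 10 * L := by
    rw [hL, show (10:ℝ) = ((10:ℕ):ℝ) by norm_num, ← Real.log_pow]
    exact Real.log_le_log (by linarith) hz'
  have h1 := Chebyshev.psi_ge' (x := z) (by linarith)
  have h2 := Chebyshev.psi_le_primeCounting_mul_log' z
  have h3 : Real.log (z + 2) ≤ (z + 2) / 16 + 2 := by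
    have := Real.log_le_sub_one_of_pos (x := (z + 2) / 16) (by linarith)
    rw [Real.log_div (by linarith) (by norm_num), show (16:ℝ) = 2 ^ 4 by norm_num, Real.log_pow] at this
    have := Real.log_two_lt_d9
    push_cast at *
    linarith
  have h4 : z / 2 ≤ (z - 1) * Real.log 2 - Real.log (z + 2) := by
    have := Real.log_two_gt_d9
    nlinarith
  have h5 : z / 2 ≤ (Nat.primeCounting ⌊z⌋₊ : ℝ) * (10 * L) := by
    have : (Nat.primeCounting ⌊z⌋₊ : ℝ) * Real.log z ≤ (Nat.primeCounting ⌊z⌋₊ : ℝ) * (10 * L) := by gcongr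
    linarith
  have h6 : (Nat.primeCounting ⌊z⌋₊ : ℝ) ≤ N + (((Finset.Icc N ⌊z⌋₊).filter Nat.Prime).card : ℝ) := by
    rw [← Nat.primesLE_card_eq_primeCounting]
    have : Nat.primesLE ⌊z⌋₊ ⊆ Finset.range N ∪ ((Finset.Icc N ⌊z⌋₊).filter Nat.Prime) := by
      intro p hp
      rw [Nat.mem_primesLE] at hp
      rw [Finset.mem_union, Finset.mem_range, Finset.mem_filter, Finset.mem_Icc]
      by_cases h : p < N
      · exact Or.inl h
      · exact Or.inr ⟨⟨by omega, hp.1⟩, hp.2⟩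
    have := (Finset.card_le_card this).trans (Finset.card_union_le _ _)
    rw [Finset.card_range] at this
    exact_mod_cast this
  rw [div_le_iff₀ (by positivity)]
  have h7 : N * (10 * L) ≤ z / 4 := by
    have : (N:ℝ) * (10 * L) ≤ (2 * y) * (10 * y) := by gcongr
    have : 80 * y ^ 2 ≤ y ^ 5 := by
      have : (80:ℝ) ≤ y ^ 3 := by
        have := pow_le_pow_left₀ (by norm_num) hy 3
        norm_num at this ⊢; linarith
      nlinarith [sq_nonneg y]
    nlinarith
  nlinarith

lemma main_large (x y : ℝ) (hy : 4096 ≤ y) (hxy : x = y ^ 10) :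
    1 / 160 * x * ((∏ p ∈ (⌈y⌉₊).primesBelow, ((1:ℝ) + 1 / p)⁻¹) * WW ⌈y⌉₊) ≤
      ∑ n ∈ Finset.Icc 1 ⌊x⌋₊, (Delta n : ℝ) := by
  set N := ⌈y⌉₊ with hNdef
  set L := Real.log y with hL
  have hL0 : 0 < L := Real.log_pos (by linarith)
  have hyN : y ≤ N := Nat.le_ceil y
  have hN2 : (N:ℝ) ≤ 2 * y := by
    have := Nat.ceil_lt_add_one (a := y) (by linarith)
    linarith
  have hNpos : 0 < N := by
    have : (0:ℝ) < N := by linarith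
    exact_mod_cast this
  have hLN : L ≤ Real.log N := Real.log_le_log (by linarith) hyN
  have hLN2 : Real.log N ≤ Real.log 2 + L := by
    rw [hL, ← Real.log_mul (by norm_num) (by linarith)]
    exact Real.log_le_log (by linarith) hN2
  have hL12 : 12 * Real.log 2 ≤ L := by
    rw [show (12:ℝ) = ((12:ℕ):ℝ) by norm_num, ← Real.log_pow]
    exact Real.log_le_log (by norm_num) (by norm_num; linarith)
  have hlog4 : Real.log 4 = 2 * Real.log 2 := by
    rw [show (4:ℝ) = 2 ^ 2 by norm_num, Real.log_pow]; norm_num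
  have hW := WW_nonneg N
  set T := (MM N).divisors.filter (fun n : ℕ => (n:ℝ) ≤ y ^ 5) with hT
  have hx0 : 0 < x := by rw [hxy]; positivity
  -- tail
  have htail : WW N / 2 ≤ ∑ n ∈ T, (Delta n : ℝ) / n := by
    have hsplit : WW N = ∑ n ∈ T, (Delta n : ℝ) / n +
        ∑ n ∈ (MM N).divisors.filter (fun n : ℕ => ¬ ((n:ℝ) ≤ y ^ 5)), (Delta n : ℝ) / n :=
      (Finset.sum_filter_add_sum_filter_not _ _ _).symm
    have h1 : (∑ n ∈ (MM N).divisors.filter (fun n : ℕ => ¬ ((n:ℝ) ≤ y ^ 5)), (Delta n : ℝ) / n) * (5 * L) ≤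
        ∑ n ∈ (MM N).divisors, (Delta n : ℝ) / n * Real.log n := by
      rw [Finset.sum_mul]
      calc _ ≤ ∑ n ∈ (MM N).divisors.filter (fun n : ℕ => ¬ ((n:ℝ) ≤ y ^ 5)), (Delta n : ℝ) / n * Real.log n := by
            refine Finset.sum_le_sum fun n hn => ?_
            have := (Finset.mem_filter.1 hn).2
            refine mul_le_mul_of_nonneg_left ?_ (by positivity)
            rw [hL, show (5:ℝ) = ((5:ℕ):ℝ) by norm_num, ← Real.log_pow]
            exact Real.log_le_log (by positivity) (not_le.1 this).le
        _ ≤ _ := Finset.sum_le_sum_of_subset_of_nonneg (Finset.filter_subset _ _) fun n _ _ =>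
            mul_nonneg (by positivity) (Real.log_natCast_nonneg n)
    have h2 := tail_log N hNpos
    have h3 : 2 * (Real.log N + Real.log 4) * WW N ≤ 5 / 2 * L * WW N := by
      refine mul_le_mul_of_nonneg_right ?_ hW
      linarith
    have h4 : (∑ n ∈ (MM N).divisors.filter (fun n : ℕ => ¬ ((n:ℝ) ≤ y ^ 5)), (Delta n : ℝ) / n) * (5 * L) ≤ WW N / 2 * (5 * L) := by
      linarith
    have := le_of_mul_le_mul_right h4 (by positivity)
    linarith
  have hmain := inject N ⌊x⌋₊ T (Finset.filter_subset _ _)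
  have hlow : x / (40 * L) * ∑ n ∈ T, (Delta n : ℝ) / n ≤
      ∑ n ∈ T, (Delta n : ℝ) * (((Finset.Icc N (⌊x⌋₊ / n)).filter Nat.Prime).card : ℝ) := by
    rw [Finset.mul_sum]
    refine Finset.sum_le_sum fun n hn => ?_
    rw [hT, Finset.mem_filter] at hn
    have hn1 : 1 ≤ n := Nat.pos_of_mem_divisors hn.1
    have hn1' : (1:ℝ) ≤ n := by exact_mod_cast hn1
    have hc := prime_count N (x / n) L y hy hL hN2
      (by
        rw [le_div_iff₀ (by linarith), hxy]
        calc y ^ 5 * n ≤ y ^ 5 * y ^ 5 := by gcongr; exact hn.2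
          _ = _ := by ring)
      (by rw [← hxy]; exact div_le_self hx0.le hn1')
    rw [Nat.floor_div_natCast] at hc
    calc x / (40 * L) * ((Delta n : ℝ) / n) = Delta n * (x / n / (40 * L)) := by field_simp
      _ ≤ _ := by gcongr
  have hprod : (∏ p ∈ N.primesBelow, ((1:ℝ) + 1 / p)⁻¹) ≤ 2 / L := by
    rw [Finset.prod_inv_distrib]
    have := prod_lower N hNpos
    have h0 : 0 < ∏ p ∈ N.primesBelow, ((1:ℝ) + 1 / p) := Finset.prod_pos fun _ _ => by positivity
    rw [inv_le_comm₀ h0 (by positivity), inv_div]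
    linarith
  calc _ ≤ 1 / 160 * x * (2 / L * WW N) := by gcongr
    _ = x / (40 * L) * (WW N / 2) := by field_simp; ring
    _ ≤ x / (40 * L) * ∑ n ∈ T, (Delta n : ℝ) / n := by gcongr
    _ ≤ _ := hlow.trans hmain

theorem statement3 :
    ∃ c : ℝ, 0 < c ∧ ∀ x : ℝ, 1 ≤ x →
      c * x * (primeProd 1 (x ^ ((1:ℝ)/10)) * ∑ᶠ n ∈ Sset 1 (x ^ ((1:ℝ)/10)), (Delta n : ℝ) / n)
        ≤ ∑ n ∈ Finset.Icc 1 ⌊x⌋₊, (Delta n : ℝ) := by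
  obtain ⟨K, hK, hKW⟩ : ∃ K : ℝ, 0 ≤ K ∧ ∀ N : ℕ, N ≤ 4096 → WW N ≤ K :=
    ⟨WW 4096, WW_nonneg _, fun N h => WW_mono h⟩
  refine ⟨min (1/160) (1 / (4096 ^ 10 * (K + 1))), lt_min (by norm_num) (by positivity), fun x hx => ?_⟩
  rw [Sset_eq, finsum_mem_coe_finset, primeProd_eq]
  change _ * x * (_ * WW _) ≤ _
  set y := x ^ ((1:ℝ)/10) with hy
  have hx0 : 0 < x := by linarith
  have hxy : x = y ^ 10 := by
    rw [hy, ← Real.rpow_natCast, ← Real.rpow_mul hx0.le]; norm_num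
  have hy0 : 0 ≤ y := by positivity
  have hW := WW_nonneg ⌈y⌉₊
  have hP0 : 0 ≤ (∏ p ∈ (⌈y⌉₊).primesBelow, ((1:ℝ) + 1 / p)⁻¹) := Finset.prod_nonneg fun _ _ => by positivity
  rcases le_total 4096 y with h | h
  · refine le_trans ?_ (main_large x y h hxy)
    gcongr
    exact min_le_left _ _
  · have hP : (∏ p ∈ (⌈y⌉₊).primesBelow, ((1:ℝ) + 1 / p)⁻¹) ≤ 1 := by
      refine Finset.prod_le_one (fun _ _ => by positivity) fun p _ => ?_
      refine inv_le_one_of_one_le₀ ?_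
      have : (0:ℝ) ≤ 1 / p := by positivity
      linarith
    have hWK : WW ⌈y⌉₊ ≤ K := hKW _ (Nat.ceil_le.2 (by exact_mod_cast h))
    have hx' : x ≤ 4096 ^ 10 := by rw [hxy]; gcongr
    have h1 : (1:ℝ) ≤ ∑ n ∈ Finset.Icc 1 ⌊x⌋₊, (Delta n : ℝ) := by
      calc (1:ℝ) ≤ Delta 1 := by exact_mod_cast D_one
        _ ≤ _ := Finset.single_le_sum (f := fun n => (Delta n : ℝ)) (fun _ _ => by positivity)
            (Finset.mem_Icc.2 ⟨le_rfl, Nat.le_floor (by exact_mod_cast hx)⟩)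
    refine le_trans ?_ h1
    calc _ ≤ 1 / (4096 ^ 10 * (K + 1)) * 4096 ^ 10 * (1 * (K + 1)) := by
          gcongr
          · exact min_le_right _ _
          · linarith
      _ = 1 := by field_simp
end

section
/- For every B ≥ 1 there exist constants 0 < c₁(B) < c₂(B) and an absolute constant x₀ such that: if x ≥ x₀, 1 ≤ y ≤ x with Log₂ x − Log₂ y ≥ 2B², and k is a positive integer with |k − (Log₂ x − Log₂ y)| ≤ B·√(Log₂ x − Log₂ y), then c₁(B)/√(Log₂ x − Log₂ y) ≤ ∏_{y ≤ p < x}(1 + 1/p)^{-1} · ∑_{n ∈ S_{[y,x)}, ω(n) = k} 1/n ≤ c₂(B)/√(Log₂ x − Log₂ y). -/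
open Filter Topology
open scoped Classical

lemma aux_logfact (n : ℕ) : Real.log (n.factorial : ℝ)
    = ∑ p ∈ n.primesLE, (padicValNat p n.factorial : ℝ) * Real.log p := by
  rw [Real.log_nat_eq_sum_factorization, Finsupp.sum]
  rw [Finset.sum_subset (s₂ := n.primesLE)]
  · refine Finset.sum_congr rfl fun p hp => ?_
    rw [Nat.mem_primesLE] at hp
    rw [Nat.factorization_def _ hp.2]
  · intro p hp
    rw [Nat.support_factorization, Nat.mem_primeFactors] at hp
    rw [Nat.mem_primesLE]
    exact ⟨(hp.1.dvd_factorial).1 hp.2.1, hp.1⟩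
  · intro p _ hp
    rw [Finsupp.notMem_support_iff] at hp
    simp [hp]

lemma aux_mertens1_upper (n : ℕ) (hn : 1 ≤ n) :
    ∑ p ∈ n.primesLE, Real.log p / p ≤ Real.log n + Real.log 4 := by
  have hn0 : (0:ℝ) < n := by exact_mod_cast hn
  have h1 : Real.log (n.factorial : ℝ) ≤ n * Real.log n := by
    rw [← Real.log_pow]
    apply Real.log_le_log (by exact_mod_cast n.factorial_pos)
    exact_mod_cast n.factorial_le_pow
  have h2 : ∑ p ∈ n.primesLE, ((n:ℝ) / p - 1) * Real.log p ≤ Real.log (n.factorial : ℝ) := by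
    rw [aux_logfact]
    refine Finset.sum_le_sum fun p hp => ?_
    rw [Nat.mem_primesLE] at hp
    have hp1 : (1:ℝ) ≤ p := by exact_mod_cast hp.2.one_lt.le
    refine mul_le_mul_of_nonneg_right ?_ (Real.log_nonneg hp1)
    have : Fact p.Prime := ⟨hp.2⟩
    have hv : n / p ≤ padicValNat p n.factorial := by
      rw [padicValNat_factorial (b := Nat.log p n + 1) (Nat.lt_succ_self _)]
      have hm : 1 ∈ Finset.Ico 1 (Nat.log p n + 1) := by
        have := Nat.log_pos hp.2.one_lt hp.1
        exact Finset.mem_Ico.2 ⟨le_rfl, by omega⟩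
      have := Finset.single_le_sum (f := fun i => n / p ^ i) (fun i _ => Nat.zero_le _) hm
      simpa using this
    have h3 : (n:ℝ) / p - 1 ≤ ((n / p : ℕ) : ℝ) := by
      have := Nat.lt_div_mul_add (a := n) hp.2.pos
      have h4 : (n:ℝ) < (n / p : ℕ) * p + p := by exact_mod_cast this
      rw [sub_le_iff_le_add, div_le_iff₀ (by linarith)]
      linarith
    exact h3.trans (by exact_mod_cast hv)
  have h3 := Chebyshev.theta_le_log4_mul_x hn0.le
  rw [Chebyshev.theta_eq_sum_primesLE_log] at h3
  have h4 : ∑ p ∈ n.primesLE, ((n:ℝ) / p - 1) * Real.log p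
      = n * ∑ p ∈ n.primesLE, Real.log p / p - ∑ p ∈ n.primesLE, Real.log p := by
    rw [Finset.mul_sum, ← Finset.sum_sub_distrib]
    refine Finset.sum_congr rfl fun p hp => ?_
    ring
  rw [h4] at h2
  have : (n:ℝ) * ∑ p ∈ n.primesLE, Real.log p / p ≤ n * (Real.log n + Real.log 4) := by
    linarith
  exact le_of_mul_le_mul_left this hn0

lemma aux_summ : ∃ C : ℝ, 0 ≤ C ∧ ∀ n : ℕ,
    ∑ p ∈ n.primesLE, Real.log p / (p * (p - 1)) ≤ C := by
  have hs : Summable (fun p : ℕ => 4 * (1 / (p:ℝ) ^ (3/2:ℝ))) :=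
    (Real.summable_one_div_nat_rpow.2 (by norm_num)).mul_left 4
  refine ⟨∑' p : ℕ, 4 * (1 / (p:ℝ) ^ (3/2:ℝ)), tsum_nonneg fun p => by positivity, fun n => ?_⟩
  refine le_trans (Finset.sum_le_sum fun p hp => ?_)
    (hs.sum_le_tsum n.primesLE (fun p _ => by positivity))
  rw [Nat.mem_primesLE] at hp
  have hp2 : (2:ℝ) ≤ p := by exact_mod_cast hp.2.two_le
  have hl := Real.log_le_rpow_div (x := (p:ℝ)) (ε := 1/2) (by linarith) (by norm_num)
  have e1 : (p:ℝ) ^ (3/2:ℝ) = p * (p:ℝ)^(1/2:ℝ) := by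
    rw [show (3/2:ℝ) = 1 + 1/2 by norm_num, Real.rpow_add (by linarith), Real.rpow_one]
  have e2 : (p:ℝ)^(1/2:ℝ) * (p:ℝ)^(1/2:ℝ) = p := by
    rw [← Real.rpow_add (by linarith)]; norm_num
  set s := (p:ℝ)^(1/2:ℝ) with hs'
  have hs0 : 0 < s := by positivity
  rw [e1, mul_one_div, div_le_div_iff₀ (by nlinarith) (by positivity)]
  have : Real.log p * s ≤ 2 * p := by
    calc Real.log p * s ≤ (s / (1/2)) * s := by gcongr
      _ = 2 * p := by rw [← e2]; ring
  nlinarith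

lemma aux_mertens1_lower : ∃ C : ℝ, 0 ≤ C ∧ ∀ n : ℕ, 1 ≤ n →
    Real.log n - C ≤ ∑ p ∈ n.primesLE, Real.log p / p := by
  obtain ⟨C, hC, h⟩ := aux_summ
  refine ⟨C + 1, by linarith, fun n hn => ?_⟩
  have hn0 : (0:ℝ) < n := by exact_mod_cast hn
  have h1 : n * Real.log n - n ≤ Real.log (n.factorial : ℝ) := by
    have := Stirling.le_log_factorial_stirling (n := n) (by omega)
    have h2 : 0 ≤ Real.log n := Real.log_nonneg (by exact_mod_cast hn)
    have h3 : 0 ≤ Real.log (2 * Real.pi) := Real.log_nonneg (by linarith [Real.pi_gt_three])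
    linarith
  have h2 : Real.log (n.factorial : ℝ) ≤
      n * ∑ p ∈ n.primesLE, (Real.log p / p + Real.log p / (p * (p - 1))) := by
    rw [aux_logfact, Finset.mul_sum]
    refine Finset.sum_le_sum fun p hp => ?_
    rw [Nat.mem_primesLE] at hp
    have hp2 : (2:ℝ) ≤ p := by exact_mod_cast hp.2.two_le
    have : Fact p.Prime := ⟨hp.2⟩
    have hv : (p - 1) * padicValNat p n.factorial ≤ n := by
      rw [sub_one_mul_padicValNat_factorial]; omega
    have hv' : ((p:ℝ) - 1) * padicValNat p n.factorial ≤ n := by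
      have : (((p - 1 : ℕ) : ℝ)) * padicValNat p n.factorial ≤ n := by exact_mod_cast hv
      rwa [Nat.cast_sub hp.2.one_lt.le, Nat.cast_one] at this
    have hl : 0 ≤ Real.log p := Real.log_nonneg (by linarith)
    have e : (n:ℝ) * (Real.log p / p + Real.log p / (p * (p - 1))) = n / (p - 1) * Real.log p := by
      have : (p:ℝ) - 1 ≠ 0 := by linarith
      have : (p:ℝ) ≠ 0 := by linarith
      field_simp
      ring
    rw [e]
    refine mul_le_mul_of_nonneg_right ?_ hl
    rw [le_div_iff₀ (by linarith)]
    linarith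
  rw [Finset.sum_add_distrib] at h2
  have h3 := h n
  have : (n:ℝ) * (Real.log n - 1) ≤ n * (∑ p ∈ n.primesLE, Real.log p / p
      + ∑ p ∈ n.primesLE, Real.log p / (p * (p - 1))) := by linarith
  have := le_of_mul_le_mul_left this hn0
  linarith

noncomputable def auxc (n : ℕ) : ℝ := if n.Prime then Real.log n / n else 0

lemma aux_sum_auxc (n : ℕ) : ∑ p ∈ Finset.range (n+1), auxc p = ∑ p ∈ n.primesLE, Real.log p / p := by
  have : n.primesLE = (Finset.range (n+1)).filter Nat.Prime := by
    ext p; simp [Nat.mem_primesLE]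
  rw [this, Finset.sum_filter]
  rfl

lemma auxc_bd (n : ℕ) : 0 ≤ auxc n ∧ auxc n ≤ 1 := by
  unfold auxc
  split_ifs with h
  · have hp : (2:ℝ) ≤ n := by exact_mod_cast h.two_le
    refine ⟨div_nonneg (Real.log_nonneg (by linarith)) (by linarith), ?_⟩
    rw [div_le_one (by linarith)]
    exact (Real.log_le_sub_one_of_pos (by linarith)).trans (by linarith)
  · norm_num

lemma aux_mertens1 : ∃ C : ℝ, 0 ≤ C ∧ ∀ n : ℕ, 1 ≤ n →
    |∑ p ∈ Finset.range n, auxc p - Real.log n| ≤ C := by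
  obtain ⟨C, hC, h⟩ := aux_mertens1_lower
  have hl4 : 0 ≤ Real.log 4 := Real.log_nonneg (by norm_num)
  refine ⟨C + Real.log 4 + 1, by linarith, fun n hn => ?_⟩
  have h1 := aux_mertens1_upper n hn
  have h2 := h n hn
  rw [← aux_sum_auxc, Finset.sum_range_succ] at h1 h2
  have := auxc_bd n
  rw [abs_le]
  constructor <;> linarith

lemma aux_abel (e g : ℕ → ℝ) (M : ℕ) (K : ℝ) (hg : ∀ n, M ≤ n → 0 ≤ g n)
    (hga : ∀ n, M ≤ n → g (n+1) ≤ g n)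
    (he : ∀ n, M ≤ n → |∑ i ∈ Finset.Ico M n, e i| ≤ K) (X : ℕ) (hX : M ≤ X) :
    |∑ i ∈ Finset.Ico M X, e i * g i| ≤ K * g M := by
  have key : ∀ n, M ≤ n → ∑ i ∈ Finset.Ico M n, e i * g i
      = (∑ i ∈ Finset.Ico M n, e i) * g n
        + ∑ j ∈ Finset.Ico M n, (∑ i ∈ Finset.Ico M (j+1), e i) * (g j - g (j+1)) := by
    intro n hn
    induction n, hn using Nat.le_induction with
    | base => simp
    | succ n hn ih =>
      rw [Finset.sum_Ico_succ_top hn, ih, Finset.sum_Ico_succ_top hn, Finset.sum_Ico_succ_top hn]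
      rw [Finset.sum_Ico_succ_top hn]
      ring
  rw [key X hX]
  have tele : ∀ n, M ≤ n → ∑ j ∈ Finset.Ico M n, (g j - g (j+1)) = g M - g n := by
    intro n hn
    induction n, hn using Nat.le_induction with
    | base => simp
    | succ n hn ih =>
      rw [Finset.sum_Ico_succ_top hn, ih]; ring
  have h2 : |∑ j ∈ Finset.Ico M X, (∑ i ∈ Finset.Ico M (j+1), e i) * (g j - g (j+1))|
      ≤ K * (g M - g X) := by
    rw [← tele X hX, Finset.mul_sum]
    refine (Finset.abs_sum_le_sum_abs _ _).trans (Finset.sum_le_sum fun j hj => ?_)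
    rw [Finset.mem_Ico] at hj
    have := hga j hj.1
    rw [abs_mul, abs_of_nonneg (a := g j - g (j+1)) (by linarith)]
    exact mul_le_mul_of_nonneg_right (he _ (by omega)) (by linarith)
  have h1 : |(∑ i ∈ Finset.Ico M X, e i) * g X| ≤ K * g X := by
    rw [abs_mul, abs_of_nonneg (hg X hX)]
    exact mul_le_mul_of_nonneg_right (he X hX) (hg X hX)
  calc _ ≤ _ := abs_add_le _ _
    _ ≤ K * g M := by linarith

lemma aux_loglog (a b : ℝ) (ha : 1 < a) (hab : a ≤ b) :
    (Real.log b - Real.log a) / Real.log b ≤ Real.log (Real.log b) - Real.log (Real.log a) ∧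
    Real.log (Real.log b) - Real.log (Real.log a) ≤ (Real.log b - Real.log a) / Real.log a := by
  have h1 : 0 < Real.log a := Real.log_pos ha
  have h2 : 0 < Real.log b := Real.log_pos (by linarith)
  rw [← Real.log_div h2.ne' h1.ne']
  constructor
  · have := Real.one_sub_inv_le_log_of_pos (x := Real.log b / Real.log a) (by positivity)
    refine le_trans (le_of_eq ?_) this
    field_simp
  · have := Real.log_le_sub_one_of_pos (x := Real.log b / Real.log a) (by positivity)
    refine le_trans this (le_of_eq ?_)
    field_simp

lemma aux_mertens2 : ∃ C : ℝ, 0 ≤ C ∧ ∀ M X : ℕ, 2 ≤ M → M ≤ X →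
    |∑ p ∈ (Finset.Ico M X).filter Nat.Prime, (1:ℝ) / p
      - (Real.log (Real.log X) - Real.log (Real.log M))| ≤ C / Real.log M := by
  obtain ⟨C, hC, h⟩ := aux_mertens1
  refine ⟨2 * C + 1, by linarith, fun M X hM hX => ?_⟩
  set g : ℕ → ℝ := fun n => 1 / Real.log n with hg
  set d : ℕ → ℝ := fun n => Real.log ((n+1 : ℕ) : ℝ) - Real.log n with hd
  have hlog : ∀ n : ℕ, M ≤ n → 0 < Real.log n := fun n hn =>
    Real.log_pos (by exact_mod_cast (by omega : 1 < n))
  have hmono : ∀ n : ℕ, M ≤ n → Real.log n ≤ Real.log ((n+1:ℕ):ℝ) := fun n hn =>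
    Real.log_le_log (by exact_mod_cast (by omega : 0 < n)) (by exact_mod_cast n.le_succ)
  have hga : ∀ n, M ≤ n → g (n+1) ≤ g n := fun n hn =>
    one_div_le_one_div_of_le (hlog n hn) (hmono n hn)
  have hg0 : ∀ n, M ≤ n → 0 ≤ g n := fun n hn => by have := hlog n hn; positivity
  have sumd : ∀ n, M ≤ n → ∑ i ∈ Finset.Ico M n, d i = Real.log n - Real.log M := by
    intro n hn
    exact Finset.sum_Ico_sub (fun n : ℕ => Real.log (n:ℝ)) hn
  have hA := aux_abel (fun n => auxc n - d n) g M (2 * C) hg0 hga (by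
    intro n hn
    rw [Finset.sum_sub_distrib, sumd n hn, Finset.sum_Ico_eq_sub _ hn]
    have a1 := h n (by omega)
    have a2 := h M (by omega)
    rw [abs_le] at *
    constructor <;> linarith [a1.1, a1.2, a2.1, a2.2]) X hX
  have e1 : ∑ p ∈ (Finset.Ico M X).filter Nat.Prime, (1:ℝ) / p
      = ∑ i ∈ Finset.Ico M X, auxc i * g i := by
    rw [Finset.sum_filter]
    refine Finset.sum_congr rfl fun p hp => ?_
    rw [Finset.mem_Ico] at hp
    have := hlog p hp.1
    unfold auxc
    split_ifs
    · simp only [hg]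
      field_simp
    · simp
  have e2 : ∑ i ∈ Finset.Ico M X, (auxc i - d i) * g i
     = ∑ i ∈ Finset.Ico M X, auxc i * g i - ∑ i ∈ Finset.Ico M X, d i * g i := by
    rw [← Finset.sum_sub_distrib]
    exact Finset.sum_congr rfl fun p hp => by ring
  have hH : ∑ i ∈ Finset.Ico M X, (Real.log (Real.log ((i+1:ℕ):ℝ)) - Real.log (Real.log i))
      = Real.log (Real.log X) - Real.log (Real.log M) :=
    Finset.sum_Ico_sub (fun n : ℕ => Real.log (Real.log (n:ℝ))) hX
  have hG : ∑ i ∈ Finset.Ico M X, (g i - g (i+1)) = g M - g X := by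
    have := Finset.sum_Ico_sub (fun n : ℕ => - g n) hX
    rw [show g M - g X = - g X - - g M by ring, ← this]
    exact Finset.sum_congr rfl fun p hp => by ring
  have b1 : Real.log (Real.log X) - Real.log (Real.log M) ≤ ∑ i ∈ Finset.Ico M X, d i * g i := by
    rw [← hH]
    refine Finset.sum_le_sum fun i hi => ?_
    rw [Finset.mem_Ico] at hi
    have := (aux_loglog i ((i+1:ℕ):ℝ) (by exact_mod_cast (by omega : 1 < i))
      (by exact_mod_cast i.le_succ)).2
    refine this.trans (le_of_eq ?_)
    simp only [hd, hg]; ring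
  have b2 : ∑ i ∈ Finset.Ico M X, d i * g i
      ≤ Real.log (Real.log X) - Real.log (Real.log M) + (g M - g X) := by
    rw [← hH, ← hG, ← Finset.sum_add_distrib]
    refine Finset.sum_le_sum fun i hi => ?_
    rw [Finset.mem_Ico] at hi
    have hi0 : (0:ℝ) < i := by exact_mod_cast (by omega : 0 < i)
    have := (aux_loglog i ((i+1:ℕ):ℝ) (by exact_mod_cast (by omega : 1 < i))
      (by exact_mod_cast i.le_succ)).1
    have hd1 : d i ≤ 1 := by
      simp only [hd]
      rw [← Real.log_div (by positivity) hi0.ne']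
      refine (Real.log_le_sub_one_of_pos (by positivity)).trans ?_
      have : (1:ℝ) ≤ i := by exact_mod_cast (by omega : 1 ≤ i)
      push_cast
      rw [sub_le_iff_le_add, div_le_iff₀ hi0]
      linarith
    have e : (Real.log ((i+1:ℕ):ℝ) - Real.log i) / Real.log ((i+1:ℕ):ℝ) = d i * g (i+1) := by
      simp only [hd, hg]; ring
    rw [e] at this
    have : d i * (g i - g (i+1)) ≤ 1 * (g i - g (i+1)) :=
      mul_le_mul_of_nonneg_right hd1 (by linarith [hga i hi.1])
    linarith
  rw [e2] at hA
  rw [e1, show (2 * C + 1) / Real.log M = 2 * C * g M + g M by simp only [hg]; ring]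
  have := hg0 X hX
  have := hg0 M le_rfl
  rw [abs_le] at *
  constructor <;> linarith [hA.1, hA.2]

noncomputable def auxE (a : ℕ → ℝ) (S : Finset ℕ) (k : ℕ) : ℝ :=
  ∑ T ∈ Finset.powersetCard k S, ∏ p ∈ T, a p

lemma auxE_zero (a : ℕ → ℝ) (S : Finset ℕ) : auxE a S 0 = 1 := by simp [auxE]

lemma auxE_empty (a : ℕ → ℝ) (k : ℕ) : auxE a ∅ (k+1) = 0 := by
  unfold auxE
  rw [Finset.powersetCard_eq_empty.2 (by simp)]
  simp

lemma auxE_insert (a : ℕ → ℝ) (S : Finset ℕ) (q : ℕ) (hq : q ∉ S) (k : ℕ) :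
    auxE a (insert q S) (k+1) = auxE a S (k+1) + a q * auxE a S k := by
  unfold auxE
  rw [Finset.powersetCard_succ_insert hq, Finset.sum_union, Finset.sum_image, Finset.mul_sum]
  · congr 1
    refine Finset.sum_congr rfl fun T hT => ?_
    rw [Finset.mem_powersetCard] at hT
    rw [Finset.prod_insert (fun h => hq (hT.1 h))]
  · intro T hT T' hT' h
    rw [Finset.mem_coe, Finset.mem_powersetCard] at hT hT'
    rw [← Finset.erase_insert (fun h => hq (hT.1 h)), h,
      Finset.erase_insert (fun h => hq (hT'.1 h))]
  · rw [Finset.disjoint_left]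
    intro T hT hT'
    rw [Finset.mem_powersetCard] at hT
    rw [Finset.mem_image] at hT'
    obtain ⟨U, _, rfl⟩ := hT'
    exact hq (hT.1 (Finset.mem_insert_self _ _))

lemma auxE_nonneg (a : ℕ → ℝ) (ha : ∀ p, 0 ≤ a p) (S : Finset ℕ) (k : ℕ) : 0 ≤ auxE a S k :=
  Finset.sum_nonneg fun _ _ => Finset.prod_nonneg fun p _ => ha p

lemma auxE_upper1 (a : ℕ → ℝ) (ha : ∀ p, 0 ≤ a p) (S : Finset ℕ) :
    ∀ k : ℕ, (k+1) * auxE a S (k+1) ≤ (∑ p ∈ S, a p) * auxE a S k := by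
  induction S using Finset.induction_on with
  | empty => intro k; simp [auxE_empty]
  | insert q S hq ih =>
    intro k
    rw [Finset.sum_insert hq, auxE_insert a S q hq]
    have hP : 0 ≤ ∑ p ∈ S, a p := Finset.sum_nonneg fun p _ => ha p
    cases k with
    | zero =>
      have := ih 0
      simp only [auxE_zero] at *
      push_cast at *
      linarith
    | succ k =>
      rw [auxE_insert a S q hq]
      have h1 := ih (k+1)
      have h2 := mul_le_mul_of_nonneg_left (ih k) (ha q)
      have h3 := mul_nonneg (mul_nonneg (ha q) (ha q)) (auxE_nonneg a ha S k)
      push_cast at *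
      nlinarith

lemma auxE_lower1 (a : ℕ → ℝ) (ha : ∀ p, 0 ≤ a p) (S : Finset ℕ) :
    (∑ p ∈ S, a p) ≤ auxE a S 1 ∧
    ∀ k : ℕ, (∑ p ∈ S, a p) * auxE a S (k+1) - (∑ p ∈ S, a p ^ 2) * auxE a S k
      ≤ (k+2) * auxE a S (k+2) := by
  induction S using Finset.induction_on with
  | empty => simp [auxE_empty]
  | insert q S hq ih =>
    obtain ⟨ih0, ih⟩ := ih
    rw [Finset.sum_insert hq, Finset.sum_insert hq, auxE_insert a S q hq, auxE_zero]
    refine ⟨by linarith, fun k => ?_⟩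
    rw [auxE_insert a S q hq, auxE_insert a S q hq]
    cases k with
    | zero =>
      have := ih 0
      have h2 := mul_le_mul_of_nonneg_left ih0 (ha q)
      simp only [auxE_zero, zero_add] at *
      push_cast at *
      nlinarith
    | succ k =>
      rw [auxE_insert a S q hq]
      have h1 := ih (k+1)
      have h2 := mul_le_mul_of_nonneg_left (ih k) (ha q)
      have h3 := mul_nonneg (pow_nonneg (ha q) 3) (auxE_nonneg a ha S k)
      push_cast at *
      nlinarith

lemma auxE_upper (a : ℕ → ℝ) (ha : ∀ p, 0 ≤ a p) (S : Finset ℕ) (k : ℕ) :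
    (k.factorial : ℝ) * auxE a S k ≤ (∑ p ∈ S, a p) ^ k := by
  have hP : 0 ≤ ∑ p ∈ S, a p := Finset.sum_nonneg fun p _ => ha p
  induction k with
  | zero => simp [auxE_zero]
  | succ k ih =>
    have h1 := auxE_upper1 a ha S k
    have h2 := mul_le_mul_of_nonneg_left h1 (Nat.cast_nonneg (α := ℝ) k.factorial)
    have h3 := mul_le_mul_of_nonneg_left ih hP
    rw [Nat.factorial_succ, pow_succ]
    push_cast
    nlinarith

lemma auxE_lower (a : ℕ → ℝ) (ha : ∀ p, 0 ≤ a p) (S : Finset ℕ) (k : ℕ) :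
    (∑ p ∈ S, a p) ^ k * ((∑ p ∈ S, a p) ^ 2 - (k * (k-1) / 2) * ∑ p ∈ S, a p ^ 2)
      ≤ (∑ p ∈ S, a p) ^ 2 * ((k.factorial : ℝ) * auxE a S k) := by
  have hP : 0 ≤ ∑ p ∈ S, a p := Finset.sum_nonneg fun p _ => ha p
  have hQ : 0 ≤ ∑ p ∈ S, a p ^ 2 := Finset.sum_nonneg fun p _ => by positivity
  have hl := auxE_lower1 a ha S
  have hu := auxE_upper a ha S
  set P := ∑ p ∈ S, a p
  set Q := ∑ p ∈ S, a p ^ 2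
  induction k with
  | zero => simp [auxE_zero]
  | succ k ih =>
    cases k with
    | zero =>
      have := mul_le_mul_of_nonneg_left hl.1 (sq_nonneg P)
      simp
      nlinarith
    | succ k =>
      have h1 := hl.2 k
      have h2 := mul_le_mul_of_nonneg_left h1
        (mul_nonneg (sq_nonneg P) (Nat.cast_nonneg (α := ℝ) (k+1).factorial))
      have h3 := mul_le_mul_of_nonneg_left ih hP
      have h4 := mul_le_mul_of_nonneg_left (hu k) (mul_nonneg (mul_nonneg (sq_nonneg P) hQ)
        (by positivity : (0:ℝ) ≤ k + 1))
      rw [Nat.factorial_succ (k+1)]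
      have e : ((k+1).factorial : ℝ) = (k+1) * k.factorial := by
        rw [Nat.factorial_succ]; push_cast; ring
      calc P ^ (k+1+1) * (P ^ 2 - (((k+1+1:ℕ):ℝ) * (((k+1+1:ℕ):ℝ) - 1)/2) * Q)
          = P * (P ^ (k+1) * (P ^ 2 - (((k+1:ℕ):ℝ) * (((k+1:ℕ):ℝ) - 1)/2) * Q))
            - P ^ 2 * Q * (k+1) * P ^ k := by push_cast; ring
        _ ≤ P * (P ^ 2 * (((k+1).factorial : ℝ) * auxE a S (k+1)))
            - P ^ 2 * Q * (k+1) * (k.factorial * auxE a S k) := by linarith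
        _ = P ^ 2 * ((k+1).factorial : ℝ) * (P * auxE a S (k+1) - Q * auxE a S k) := by
            rw [e]; ring
        _ ≤ P ^ 2 * ((k+1).factorial : ℝ) * ((k+2) * auxE a S (k+2)) := h2
        _ = _ := by push_cast; ring

lemma aux_fact_upper (k : ℕ) (hk : 1 ≤ k) :
    (k.factorial : ℝ) ≤ Real.exp 1 * Real.sqrt k * (k / Real.exp 1) ^ k := by
  obtain ⟨m, rfl⟩ : ∃ m, k = m + 1 := ⟨k - 1, by omega⟩
  have := Stirling.stirlingSeq'_antitone (Nat.zero_le m)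
  simp only [Function.comp, Nat.succ_eq_add_one, zero_add] at this
  rw [Stirling.stirlingSeq_one, Stirling.stirlingSeq, div_le_iff₀ (by positivity)] at this
  refine this.trans (le_of_eq ?_)
  rw [Real.sqrt_mul (by norm_num)]
  field_simp

lemma aux_poisson_upper (P : ℝ) (hP : 0 ≤ P) (k : ℕ) (hk : 1 ≤ k) :
    Real.exp (-P) * (P ^ k / k.factorial) ≤ 1 / Real.sqrt k := by
  have hk0 : (0:ℝ) < k := by exact_mod_cast hk
  have h1 := Stirling.le_factorial_stirling k
  have h2 : Real.sqrt k ≤ Real.sqrt (2 * Real.pi * k) := by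
    apply Real.sqrt_le_sqrt
    nlinarith [Real.pi_gt_three]
  have h3 : Real.sqrt k * (k / Real.exp 1) ^ k ≤ k.factorial :=
    le_trans (mul_le_mul_of_nonneg_right h2 (by positivity)) h1
  have h4 : Real.exp (-P) * P ^ k ≤ (k / Real.exp 1) ^ k := by
    have : P / k ≤ Real.exp (P / k - 1) := by
      have := Real.add_one_le_exp (P / k - 1); linarith
    have h5 : (P / k) ^ k ≤ Real.exp (P - k) := by
      calc (P / k) ^ k ≤ (Real.exp (P / k - 1)) ^ k := by gcongr
        _ = Real.exp (P - k) := by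
          rw [← Real.exp_nat_mul]; congr 1; field_simp
    rw [div_pow, div_le_iff₀ (by positivity)] at h5
    calc Real.exp (-P) * P ^ k ≤ Real.exp (-P) * (Real.exp (P - k) * k ^ k) := by gcongr
      _ = (k / Real.exp 1) ^ k := by
        rw [← mul_assoc, ← Real.exp_add, div_pow, ← Real.exp_nat_mul, mul_one,
          show -P + (P - k) = -(k:ℝ) by ring, Real.exp_neg]
        ring
  rw [← mul_div_assoc, div_le_div_iff₀ (by positivity) (by positivity)]
  calc Real.exp (-P) * P ^ k * Real.sqrt k ≤ (k / Real.exp 1) ^ k * Real.sqrt k := by gcongr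
    _ ≤ 1 * k.factorial := by linarith

lemma aux_poisson_lower (P : ℝ) (hP : 0 < P) (k : ℕ) (hk : 1 ≤ k) :
    Real.exp (-((k - P) ^ 2 / P)) / (Real.exp 1 * Real.sqrt k)
      ≤ Real.exp (-P) * (P ^ k / k.factorial) := by
  have hk0 : (0:ℝ) < k := by exact_mod_cast hk
  have h1 := aux_fact_upper k hk
  have h4 : Real.exp (-((k - P) ^ 2 / P)) * (k / Real.exp 1) ^ k ≤ Real.exp (-P) * P ^ k := by
    have h5 : Real.exp (k - k ^ 2 / P) ≤ (P / k) ^ k := by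
      have : Real.exp (1 - k / P) ≤ P / k := by
        rw [← Real.le_log_iff_exp_le (by positivity)]
        have := Real.one_sub_inv_le_log_of_pos (x := P / k) (by positivity)
        rwa [inv_div] at this
      calc Real.exp (k - k ^ 2 / P) = (Real.exp (1 - k / P)) ^ k := by
            rw [← Real.exp_nat_mul]; congr 1; ring
        _ ≤ _ := by gcongr
    rw [div_pow, le_div_iff₀ (by positivity)] at h5
    calc Real.exp (-((k - P) ^ 2 / P)) * (k / Real.exp 1) ^ k
        = Real.exp (-P) * (Real.exp (k - k ^ 2 / P) * k ^ k) := by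
          rw [← mul_assoc, ← Real.exp_add, div_pow, ← Real.exp_nat_mul, mul_one,
            show -((k - P) ^ 2 / P) = (-P + (k - k ^ 2 / P)) + k by field_simp; ring,
            Real.exp_add _ (k:ℝ)]
          field_simp
      _ ≤ _ := by gcongr
  rw [← mul_div_assoc, div_le_div_iff₀ (by positivity) (by positivity)]
  calc _ ≤ Real.exp (-((k - P) ^ 2 / P)) * (Real.exp 1 * Real.sqrt k * (k / Real.exp 1) ^ k) := by
        gcongr
    _ = (Real.exp (-((k - P) ^ 2 / P)) * (k / Real.exp 1) ^ k) * (Real.exp 1 * Real.sqrt k) := by ring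
    _ ≤ _ := by gcongr

noncomputable def auxS (y x : ℝ) : Finset ℕ := (Finset.Ico ⌈y⌉₊ ⌈x⌉₊).filter Nat.Prime

lemma mem_auxS (y x : ℝ) (p : ℕ) : p ∈ auxS y x ↔ p.Prime ∧ y ≤ (p:ℝ) ∧ (p:ℝ) < x := by
  unfold auxS
  rw [Finset.mem_filter, Finset.mem_Ico, Nat.ceil_le, Nat.lt_ceil]
  tauto

lemma aux_primeProd (y x : ℝ) : primeProd y x = ∏ p ∈ auxS y x, ((1 : ℝ) + 1 / p)⁻¹ := by
  unfold primeProd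
  rw [← finprod_mem_coe_finset]
  congr 1
  ext p
  rw [Finset.mem_coe, mem_auxS]
  rfl

lemma aux_finsum (y x : ℝ) (k : ℕ) :
    ∑ᶠ n ∈ {n | n ∈ Sset y x ∧ omegaN n = k}, ((n : ℝ))⁻¹
      = auxE (fun p => 1 / (p:ℝ)) (auxS y x) k := by
  unfold auxE
  rw [← finsum_mem_coe_finset]
  refine finsum_mem_eq_of_bijOn (fun n => n.primeFactors) ⟨?_, ?_, ?_⟩ ?_
  · rintro n ⟨⟨h0, hs, hp⟩, hk⟩
    rw [Finset.mem_coe, Finset.mem_powersetCard]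
    refine ⟨fun p h => ?_, hk⟩
    rw [mem_auxS]
    exact ⟨Nat.prime_of_mem_primeFactors h, hp p h⟩
  · rintro n ⟨⟨h0, hs, hp⟩, hk⟩ m ⟨⟨h0', hs', hp'⟩, hk'⟩ h
    rw [← Nat.prod_primeFactors_of_squarefree hs, ← Nat.prod_primeFactors_of_squarefree hs']
    simp only at h
    rw [h]
  · intro T hT
    rw [Finset.mem_coe, Finset.mem_powersetCard] at hT
    have hpr : ∀ p ∈ T, p.Prime := fun p hp => ((mem_auxS y x p).1 (hT.1 hp)).1
    have hpf := Nat.primeFactors_prod hpr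
    refine ⟨∏ p ∈ T, p, ⟨⟨Finset.prod_pos fun p hp => (hpr p hp).pos, ?_, ?_⟩, ?_⟩, hpf⟩
    · apply Finset.squarefree_prod_of_pairwise_isCoprime
      · intro p hp q hq hpq
        exact Nat.coprime_iff_isRelPrime.1 ((Nat.coprime_primes (hpr p hp) (hpr q hq)).2 hpq)
      · exact fun p hp => (hpr p hp).prime.squarefree
    · intro p hp
      rw [hpf] at hp
      exact ((mem_auxS y x p).1 (hT.1 hp)).2
    · unfold omegaN
      rw [hpf, hT.2]
  · rintro n ⟨⟨h0, hs, hp⟩, hk⟩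
    conv_lhs => rw [← Nat.prod_primeFactors_of_squarefree hs]
    push_cast
    rw [← Finset.prod_inv_distrib]
    simp

lemma aux_prod_lower (S : Finset ℕ) :
    Real.exp (-∑ p ∈ S, 1 / (p:ℝ)) ≤ ∏ p ∈ S, ((1 : ℝ) + 1 / p)⁻¹ := by
  rw [← Finset.sum_neg_distrib, Real.exp_sum]
  refine Finset.prod_le_prod (fun _ _ => (Real.exp_pos _).le) fun p _ => ?_
  rw [Real.exp_neg]
  have h : (0:ℝ) ≤ 1 / p := by positivity
  refine inv_anti₀ (by linarith) ?_
  have := Real.add_one_le_exp (1 / (p:ℝ))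
  linarith

lemma aux_prod_upper (S : Finset ℕ) :
    ∏ p ∈ S, ((1 : ℝ) + 1 / p)⁻¹ ≤
      Real.exp (-∑ p ∈ S, 1 / (p:ℝ)) * Real.exp (∑ p ∈ S, (1 / (p:ℝ)) ^ 2) := by
  rw [← Real.exp_add, ← Finset.sum_neg_distrib, ← Finset.sum_add_distrib, Real.exp_sum]
  refine Finset.prod_le_prod (fun p _ => by positivity) fun p _ => ?_
  have h : (0:ℝ) ≤ 1 / p := by positivity
  set a := 1 / (p:ℝ)
  rw [show -a + a ^ 2 = -(a - a ^ 2) by ring, Real.exp_neg]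
  refine inv_anti₀ (Real.exp_pos _) ?_
  rw [← Real.le_log_iff_exp_le (by linarith)]
  refine le_trans ?_ (Real.le_log_one_add_of_nonneg h)
  rw [le_div_iff₀ (by linarith)]
  nlinarith [pow_nonneg h 3, sq_nonneg a]

lemma aux_sq (M X : ℕ) (hM : 2 ≤ M) :
    ∑ n ∈ Finset.Ico M X, (1 / (n:ℝ)) ^ 2 ≤ 1 / ((M:ℝ) - 1) := by
  have hM' : (2:ℝ) ≤ M := by exact_mod_cast hM
  rcases le_total X M with h | h
  · rw [Finset.Ico_eq_empty_of_le h, Finset.sum_empty]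
    apply one_div_nonneg.2; linarith
  have : ∑ n ∈ Finset.Ico M X, (1 / (n:ℝ)) ^ 2 ≤ 1 / ((M:ℝ) - 1) - 1 / ((X:ℝ) - 1) := by
    induction X, h using Nat.le_induction with
    | base => simp
    | succ n hn ih =>
      rw [Finset.sum_Ico_succ_top hn]
      have hn' : (M:ℝ) ≤ n := by exact_mod_cast hn
      have : (1 / (n:ℝ)) ^ 2 ≤ 1 / ((n:ℝ) - 1) - 1 / (((n+1:ℕ):ℝ) - 1) := by
        push_cast
        rw [show (n:ℝ) + 1 - 1 = n by ring, div_sub_div _ _ (by linarith) (by linarith), one_div_pow,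
          div_le_div_iff₀ (by nlinarith) (by nlinarith)]
        nlinarith
      linarith
  have h2 : (0:ℝ) ≤ 1 / ((X:ℝ) - 1) := by
    have : (M:ℝ) ≤ X := by exact_mod_cast h
    apply one_div_nonneg.2; linarith
  linarith

lemma aux_Q_le (y x : ℝ) : ∑ p ∈ auxS y x, (1 / (p:ℝ)) ^ 2 ≤ 3 / 4 := by
  have hsub : auxS y x ⊆ insert 2 (Finset.Ico 3 (⌈x⌉₊)) := by
    intro p hp
    unfold auxS at hp
    rw [Finset.mem_filter, Finset.mem_Ico] at hp
    have := hp.2.two_le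
    rw [Finset.mem_insert, Finset.mem_Ico]
    omega
  refine (Finset.sum_le_sum_of_subset_of_nonneg hsub fun p _ _ => by positivity).trans ?_
  rw [Finset.sum_insert (by simp)]
  have := aux_sq 3 ⌈x⌉₊ (by norm_num)
  norm_num at *
  linarith

lemma aux_Q_le' (y x : ℝ) (hy : 2 ≤ y) : ∑ p ∈ auxS y x, (1 / (p:ℝ)) ^ 2 ≤ 2 / y := by
  have hM : y ≤ ⌈y⌉₊ := Nat.le_ceil y
  have hM2 : 2 ≤ ⌈y⌉₊ := by
    have : (2:ℝ) ≤ ⌈y⌉₊ := hy.trans hM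
    exact_mod_cast this
  refine (Finset.sum_le_sum_of_subset_of_nonneg (Finset.filter_subset _ _)
    fun p _ _ => by positivity).trans ((aux_sq _ _ hM2).trans ?_)
  rw [div_le_div_iff₀ (by linarith) (by linarith)]
  linarith

lemma LLog2_one_le (y : ℝ) : 1 ≤ LLog2 y := le_max_left _ _

lemma LLog2_mono {a b : ℝ} (ha : 0 < a) (hab : a ≤ b) : LLog2 a ≤ LLog2 b := by
  unfold LLog2
  have h1 : LLog a ≤ LLog b := max_le_max le_rfl (Real.log_le_log ha hab)
  have h0 : (0:ℝ) < LLog a := lt_of_lt_of_le one_pos (le_max_left _ _)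
  exact max_le_max le_rfl (Real.log_le_log h0 h1)

lemma log_le_exp_LLog2 (y : ℝ) : Real.log y ≤ Real.exp (LLog2 y) := by
  have h1 : Real.log y ≤ LLog y := le_max_right _ _
  have h0 : (0:ℝ) < LLog y := lt_of_lt_of_le one_pos (le_max_left _ _)
  have h2 : Real.log (LLog y) ≤ LLog2 y := le_max_right _ _
  exact h1.trans ((Real.log_le_iff_le_exp h0).1 h2)

lemma log_eq_exp_LLog2 (x : ℝ) (hx : 1 < LLog2 x) : Real.log x = Real.exp (LLog2 x) := by
  have h0 : (0:ℝ) < LLog x := lt_of_lt_of_le one_pos (le_max_left _ _)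
  have h2 : LLog2 x = Real.log (LLog x) := by
    unfold LLog2 at *
    conv_lhs => unfold LLog
    refine max_eq_right ?_
    by_contra h
    push Not at h
    conv at hx => rhs; unfold LLog
    rw [max_eq_left h.le] at hx
    exact lt_irrefl _ hx
  have h3 : Real.exp (LLog2 x) = LLog x := by rw [h2, Real.exp_log h0]
  rw [h3]
  have h4 : 1 < LLog x := by
    rw [← h3]; exact Real.one_lt_exp_iff.2 (by linarith)
  unfold LLog at *
  rcases le_total (Real.log x) 1 with h | h
  · rw [max_eq_left h] at h4; exact absurd h4 (lt_irrefl _)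
  · rw [max_eq_right h]

lemma log16 : Real.exp 1 ≤ Real.log 16 ∧ Real.log 16 ≤ 3 := by
  have : Real.log 16 = 4 * Real.log 2 := by
    rw [show (16:ℝ) = 2 ^ 4 by norm_num, Real.log_pow]; norm_num
  rw [this]
  have := Real.log_two_gt_d9
  have := Real.log_two_lt_d9
  have := Real.exp_one_lt_d9
  constructor <;> linarith

lemma LLog2_eq (y : ℝ) (hy : 16 ≤ y) : LLog2 y = Real.log (Real.log y) := by
  have h1 : Real.exp 1 ≤ Real.log y := log16.1.trans (Real.log_le_log (by norm_num) hy)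
  have h3 := Real.add_one_le_exp (1:ℝ)
  have h2 : LLog y = Real.log y := max_eq_right (by linarith)
  unfold LLog2
  rw [h2]
  unfold LLog
  exact max_eq_right ((Real.le_log_iff_exp_le (by linarith)).2 h1)

lemma aux_ceil_loglog (y : ℝ) (hy : 16 ≤ y) :
    0 ≤ Real.log (Real.log (⌈y⌉₊ : ℝ)) - Real.log (Real.log y) ∧
    Real.log (Real.log (⌈y⌉₊ : ℝ)) - Real.log (Real.log y) ≤ 1 / Real.log y := by
  have hM : y ≤ ⌈y⌉₊ := Nat.le_ceil y
  have hM2 : (⌈y⌉₊ : ℝ) < y + 1 := Nat.ceil_lt_add_one (by linarith)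
  have hl : 0 < Real.log y := Real.log_pos (by linarith)
  have hl2 : Real.log y ≤ Real.log ⌈y⌉₊ := Real.log_le_log (by linarith) hM
  refine ⟨sub_nonneg.2 (Real.log_le_log hl hl2), ?_⟩
  refine (aux_loglog y _ (by linarith) hM).2.trans ?_
  apply div_le_div_of_nonneg_right _ hl.le
  rw [← Real.log_div (by linarith) (by linarith)]
  refine (Real.log_le_sub_one_of_pos (div_pos (by linarith) (by linarith))).trans ?_
  rw [sub_le_iff_le_add, div_le_iff₀ (by linarith)]
  linarith

lemma aux_mertens_xy : ∃ C : ℝ, 0 < C ∧ ∀ x y : ℝ, 1 ≤ y → y ≤ x → 2 ≤ LLog2 x - LLog2 y →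
    |∑ p ∈ auxS y x, 1 / (p:ℝ) - (LLog2 x - LLog2 y)| ≤ C ∧
    (16 ≤ y → |∑ p ∈ auxS y x, 1 / (p:ℝ) - (LLog2 x - LLog2 y)| ≤ C / Real.log y) := by
  obtain ⟨C, hC, h⟩ := aux_mertens2
  have key : ∀ x y : ℝ, 16 ≤ y → y ≤ x →
      |∑ p ∈ auxS y x, 1 / (p:ℝ) - (LLog2 x - LLog2 y)| ≤ (C + 1) / Real.log y := by
    intro x y hy hyx
    have hM : y ≤ ⌈y⌉₊ := Nat.le_ceil y
    have hM2 : 2 ≤ ⌈y⌉₊ := by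
      have : (2:ℝ) ≤ ⌈y⌉₊ := by linarith
      exact_mod_cast this
    have h1 := h ⌈y⌉₊ ⌈x⌉₊ hM2 (Nat.ceil_mono hyx)
    have hl : 0 < Real.log y := Real.log_pos (by linarith)
    have h2 : C / Real.log ⌈y⌉₊ ≤ C / Real.log y :=
      div_le_div_of_nonneg_left hC hl (Real.log_le_log (by linarith) hM)
    have h3 := aux_ceil_loglog y hy
    have h4 := aux_ceil_loglog x (hy.trans hyx)
    have h5 : 1 / Real.log x ≤ 1 / Real.log y :=
      one_div_le_one_div_of_le hl (Real.log_le_log (by linarith) hyx)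
    rw [LLog2_eq y hy, LLog2_eq x (hy.trans hyx), add_div]
    unfold auxS
    rw [abs_le] at *
    constructor <;> linarith [h1.1, h1.2, h3.1, h3.2, h4.1, h4.2]
  have hl16 := log16
  have he := Real.add_one_le_exp (1:ℝ)
  have weak : ∀ z : ℝ, 16 ≤ z → (C + 1) / Real.log z ≤ C + 1 := by
    intro z hz
    have : Real.log 16 ≤ Real.log z := Real.log_le_log (by norm_num) hz
    rw [div_le_iff₀ (by linarith)]
    nlinarith
  refine ⟨C + 20, by linarith, fun x y hy hyx hL => ⟨?_, fun hy16 => ?_⟩⟩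
  · rcases le_total 16 y with hy16 | hy16
    · exact (key x y hy16 hyx).trans ((weak y hy16).trans (by linarith))
    · have hx16 : 16 ≤ x := by
        by_contra hx
        push Not at hx
        have h1 := LLog2_mono (by linarith : 0 < x) hx.le
        have h2 := LLog2_one_le y
        have h3 := log_eq_exp_LLog2 x (by linarith)
        have h4 : Real.log x ≤ 3 := (Real.log_le_log (by linarith) hx.le).trans hl16.2
        have h5 := Real.add_one_le_exp (LLog2 x)
        linarith
      have h1 := (key x 16 le_rfl hx16).trans (weak 16 le_rfl)
      have h2 := LLog2_one_le y
      have h3 := LLog2_mono (by linarith : 0 < y) hy16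
      have h4 : LLog2 16 ≤ 2 := by
        rw [LLog2_eq 16 le_rfl]
        have := Real.log_le_sub_one_of_pos (x := Real.log 16) (by linarith)
        linarith
      have h5 : ∑ p ∈ auxS 16 x, 1 / (p:ℝ) ≤ ∑ p ∈ auxS y x, 1 / (p:ℝ) := by
        refine Finset.sum_le_sum_of_subset_of_nonneg ?_ fun p _ _ => by positivity
        intro p hp
        rw [mem_auxS] at *
        exact ⟨hp.1, by linarith [hp.2.1], hp.2.2⟩
      have h6 : ∑ p ∈ auxS y x, 1 / (p:ℝ) ≤ ∑ p ∈ auxS 16 x, 1 / (p:ℝ) + 16 := by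
        have hsub : auxS y x ⊆ auxS 16 x ∪ Finset.range 16 := by
          intro p hp
          rw [Finset.mem_union, Finset.mem_range]
          rw [mem_auxS] at *
          by_cases hp16 : p < 16
          · exact Or.inr hp16
          · refine Or.inl ⟨hp.1, ?_, hp.2.2⟩
            push Not at hp16
            exact_mod_cast hp16
        have a1 : ∑ p ∈ auxS y x, 1 / (p:ℝ) ≤ ∑ p ∈ auxS 16 x ∪ Finset.range 16, 1 / (p:ℝ) :=
          Finset.sum_le_sum_of_subset_of_nonneg hsub fun p _ _ => by positivity
        have a2 : ∑ p ∈ auxS 16 x ∪ Finset.range 16, 1 / (p:ℝ) ≤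
            ∑ p ∈ auxS 16 x, 1 / (p:ℝ) + ∑ p ∈ Finset.range 16, 1 / (p:ℝ) := by
          rw [← Finset.sum_union_inter]
          have : 0 ≤ ∑ p ∈ auxS 16 x ∩ Finset.range 16, 1 / (p:ℝ) :=
            Finset.sum_nonneg fun p _ => by positivity
          linarith
        have a3 : ∑ p ∈ Finset.range 16, 1 / (p:ℝ) ≤ 16 := by
          have : ∑ p ∈ Finset.range 16, 1 / (p:ℝ) ≤ ∑ p ∈ Finset.range 16, (1:ℝ) := by
            refine Finset.sum_le_sum fun p _ => ?_
            rcases Nat.eq_zero_or_pos p with rfl | hp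
            · norm_num
            · rw [div_le_one (by exact_mod_cast hp)]
              exact_mod_cast hp
          simpa using this
        linarith
      rw [abs_le] at *
      constructor <;> linarith [h1.1, h1.2]
  · refine (key x y hy16 hyx).trans ?_
    have : 0 < Real.log y := Real.log_pos (by linarith)
    exact div_le_div_of_nonneg_right (by linarith) this.le

lemma aux_exists_primes (M : ℕ) (hM : 1 ≤ M) (k : ℕ) : ∃ T : Finset ℕ, T.card = k ∧
    ∀ p ∈ T, p.Prime ∧ M < p ∧ p ≤ 2 ^ k * M := by
  induction k with
  | zero => exact ⟨∅, by simp⟩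
  | succ k ih =>
    obtain ⟨T, hT, h⟩ := ih
    have hpos : 1 ≤ 2 ^ k := Nat.one_le_two_pow
    obtain ⟨q, hq, hq1, hq2⟩ := Nat.exists_prime_lt_and_le_two_mul (2 ^ k * M) (by positivity)
    have hqT : q ∉ T := fun hh => by have := (h q hh).2.2; omega
    refine ⟨insert q T, by rw [Finset.card_insert_of_notMem hqT, hT], fun p hp => ?_⟩
    rw [Finset.mem_insert] at hp
    have e : 2 ^ (k+1) * M = 2 * (2 ^ k * M) := by ring
    rw [e]
    rcases hp with rfl | hp
    · refine ⟨hq, ?_, hq2⟩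
      nlinarith
    · have := h p hp
      exact ⟨this.1, this.2.1, by omega⟩

lemma aux_exists_T (x y : ℝ) (hy : 1 ≤ y) (hL : 2 ≤ LLog2 x - LLog2 y) (hx : 0 < x) (k : ℕ)
    (hk : (k:ℝ) ≤ 2 * (LLog2 x - LLog2 y)) : ∃ T, T ∈ Finset.powersetCard k (auxS y x) := by
  have hM : y ≤ ⌈y⌉₊ := Nat.le_ceil y
  have hM2 : (⌈y⌉₊ : ℝ) < y + 1 := Nat.ceil_lt_add_one (by linarith)
  have hM1 : 1 ≤ ⌈y⌉₊ := by
    have : (1:ℝ) ≤ ⌈y⌉₊ := by linarith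
    exact_mod_cast this
  obtain ⟨T, hT, h⟩ := aux_exists_primes ⌈y⌉₊ hM1 k
  refine ⟨T, ?_⟩
  rw [Finset.mem_powersetCard]
  refine ⟨fun p hp => ?_, hT⟩
  rw [mem_auxS]
  obtain ⟨h1, h2, h3⟩ := h p hp
  have h2' : (⌈y⌉₊ : ℝ) < p := by exact_mod_cast h2
  have h3' : (p:ℝ) ≤ 2 ^ k * (⌈y⌉₊ : ℝ) := by exact_mod_cast h3
  refine ⟨h1, by linarith, ?_⟩
  have h4 : (2:ℝ) ^ k * (⌈y⌉₊ : ℝ) ≤ 2 ^ (k+1) * y := by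
    rw [pow_succ, mul_assoc]
    have : (⌈y⌉₊ : ℝ) ≤ 2 * y := by linarith
    gcongr
  refine lt_of_le_of_lt (h3'.trans h4) ?_
  rw [← Real.log_lt_log_iff (by positivity) hx, Real.log_mul (by positivity) (by linarith),
    Real.log_pow]
  have hu := LLog2_one_le y
  have hlx := log_eq_exp_LLog2 x (by linarith)
  have hly := log_le_exp_LLog2 y
  set L := LLog2 x - LLog2 y with hLdef
  rw [hlx, show LLog2 x = LLog2 y + L by rw [hLdef]; ring, Real.exp_add]
  have e1 := Real.add_one_le_exp (LLog2 y)
  have e2 := Real.quadratic_le_exp_of_nonneg (x := L) (by linarith)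
  have l2 := Real.log_two_lt_d9
  have l2' := Real.log_two_gt_d9
  push_cast
  have a1 : ((k:ℝ) + 1) * Real.log 2 ≤ (2 * L + 1) * 1 := by
    apply mul_le_mul _ (by linarith) (by linarith) (by linarith)
    linarith
  have a2 : 2 * (2 * L) ≤ Real.exp (LLog2 y) * (Real.exp L - 1) := by
    apply mul_le_mul _ _ (by linarith) (Real.exp_pos _).le
    · linarith
    · nlinarith
  nlinarith

lemma aux_core_lower (S : Finset ℕ) (k : ℕ) (hP : 0 < ∑ p ∈ S, 1 / (p:ℝ))
    (hQ : (k:ℝ) ^ 2 * ∑ p ∈ S, (1 / (p:ℝ)) ^ 2 ≤ (∑ p ∈ S, 1 / (p:ℝ)) ^ 2) :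
    1 / 2 * (Real.exp (-∑ p ∈ S, 1 / (p:ℝ)) * ((∑ p ∈ S, 1 / (p:ℝ)) ^ k / k.factorial))
      ≤ (∏ p ∈ S, ((1 : ℝ) + 1 / p)⁻¹) * auxE (fun p => 1 / (p:ℝ)) S k := by
  have hpr := aux_prod_lower S
  have ha : ∀ p : ℕ, 0 ≤ (fun p : ℕ => 1 / (p:ℝ)) p := fun p => by positivity
  have hl := auxE_lower (fun p => 1 / (p:ℝ)) ha S k
  have hE := auxE_nonneg (fun p => 1 / (p:ℝ)) ha S k
  have hQ0 : 0 ≤ ∑ p ∈ S, (1 / (p:ℝ)) ^ 2 := Finset.sum_nonneg fun p _ => by positivity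
  set P := ∑ p ∈ S, 1 / (p:ℝ)
  set Q := ∑ p ∈ S, (1 / (p:ℝ)) ^ 2
  set E := auxE (fun p => 1 / (p:ℝ)) S k
  have hf : (0:ℝ) < k.factorial := by exact_mod_cast k.factorial_pos
  have h1 : P ^ 2 / 2 ≤ P ^ 2 - (k * (k-1) / 2) * Q := by
    have : (0:ℝ) ≤ k * Q := by positivity
    nlinarith
  have h2 : P ^ k * (P ^ 2 / 2) ≤ P ^ 2 * (k.factorial * E) :=
    (mul_le_mul_of_nonneg_left h1 (by positivity)).trans hl
  have h3 : P ^ k / 2 ≤ k.factorial * E := by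
    refine le_of_mul_le_mul_left (a := P ^ 2) ?_ (by positivity)
    linarith
  have h4 : 1 / 2 * (P ^ k / k.factorial) ≤ E := by
    rw [← mul_div_assoc, div_le_iff₀ hf]
    linarith
  calc 1 / 2 * (Real.exp (-P) * (P ^ k / k.factorial))
      = Real.exp (-P) * (1 / 2 * (P ^ k / k.factorial)) := by ring
    _ ≤ Real.exp (-P) * E := by gcongr
    _ ≤ _ := by gcongr

lemma aux_core_upper (S : Finset ℕ) (k : ℕ) (hk : 1 ≤ k)
    (hQ : ∑ p ∈ S, (1 / (p:ℝ)) ^ 2 ≤ 3 / 4) :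
    (∏ p ∈ S, ((1 : ℝ) + 1 / p)⁻¹) * auxE (fun p => 1 / (p:ℝ)) S k ≤ Real.exp 1 / Real.sqrt k := by
  have hpr := aux_prod_upper S
  have ha : ∀ p : ℕ, 0 ≤ (fun p : ℕ => 1 / (p:ℝ)) p := fun p => by positivity
  have hu := auxE_upper (fun p => 1 / (p:ℝ)) ha S k
  have hE := auxE_nonneg (fun p => 1 / (p:ℝ)) ha S k
  have hP : 0 ≤ ∑ p ∈ S, 1 / (p:ℝ) := Finset.sum_nonneg fun p _ => by positivity
  have hpo := aux_poisson_upper _ hP k hk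
  set P := ∑ p ∈ S, 1 / (p:ℝ)
  set Q := ∑ p ∈ S, (1 / (p:ℝ)) ^ 2
  set E := auxE (fun p => 1 / (p:ℝ)) S k
  have hf : (0:ℝ) < k.factorial := by exact_mod_cast k.factorial_pos
  have h4 : E ≤ P ^ k / k.factorial := by
    rw [le_div_iff₀ hf]; linarith
  calc _ ≤ (Real.exp (-P) * Real.exp Q) * (P ^ k / k.factorial) := by gcongr
    _ = Real.exp Q * (Real.exp (-P) * (P ^ k / k.factorial)) := by ring
    _ ≤ Real.exp 1 * (1 / Real.sqrt k) := by gcongr; linarith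
    _ = _ := by ring

lemma aux_lower_main (S : Finset ℕ) (k : ℕ) (hk : 1 ≤ k) (B C L : ℝ) (hC : 0 ≤ C)
    (hL : 2 ≤ L) (hkL : (k:ℝ) ≤ 2 * L) (hk2 : |(k:ℝ) - L| ≤ B * Real.sqrt L)
    (hP : L / 2 ≤ ∑ p ∈ S, 1 / (p:ℝ)) (hPL : |∑ p ∈ S, 1 / (p:ℝ) - L| ≤ C)
    (hQ : (k:ℝ) ^ 2 * ∑ p ∈ S, (1 / (p:ℝ)) ^ 2 ≤ (∑ p ∈ S, 1 / (p:ℝ)) ^ 2) :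
    Real.exp (-(2 * (B + C) ^ 2)) / (4 * Real.exp 1) / Real.sqrt L
      ≤ (∏ p ∈ S, ((1 : ℝ) + 1 / p)⁻¹) * auxE (fun p => 1 / (p:ℝ)) S k := by
  refine le_trans ?_ (aux_core_lower S k (by linarith) hQ)
  have hpo := aux_poisson_lower (∑ p ∈ S, 1 / (p:ℝ)) (by linarith) k hk
  refine le_trans ?_ (mul_le_mul_of_nonneg_left hpo (by norm_num))
  set P := ∑ p ∈ S, 1 / (p:ℝ)
  have hk0 : (0:ℝ) < k := by exact_mod_cast hk
  have hs1 : 1 ≤ Real.sqrt L := Real.one_le_sqrt.2 (by linarith)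
  have hss : Real.sqrt L * Real.sqrt L = L := Real.mul_self_sqrt (by linarith)
  have h1 : Real.sqrt k ≤ 2 * Real.sqrt L := by
    rw [Real.sqrt_le_left (by positivity)]
    nlinarith
  have h2 : |(k:ℝ) - P| ≤ (B + C) * Real.sqrt L := by
    have : C ≤ C * Real.sqrt L := le_mul_of_one_le_right hC hs1
    rw [abs_le] at *
    constructor <;> linarith [hk2.1, hk2.2, hPL.1, hPL.2]
  have h3 : ((k:ℝ) - P) ^ 2 ≤ (B + C) ^ 2 * L := by
    rw [← sq_abs]
    calc |(k:ℝ) - P| ^ 2 ≤ ((B + C) * Real.sqrt L) ^ 2 := by gcongr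
      _ = (B + C) ^ 2 * L := by rw [mul_pow, sq (Real.sqrt L), hss]
  have h4 : ((k:ℝ) - P) ^ 2 / P ≤ 2 * (B + C) ^ 2 := by
    rw [div_le_iff₀ (by linarith)]
    have := mul_le_mul_of_nonneg_left hP (sq_nonneg (B + C))
    linarith
  have hk' : 0 < Real.sqrt k := Real.sqrt_pos.2 hk0
  calc Real.exp (-(2 * (B + C) ^ 2)) / (4 * Real.exp 1) / Real.sqrt L
      = 1 / 2 * (Real.exp (-(2 * (B + C) ^ 2)) / (Real.exp 1 * (2 * Real.sqrt L))) := by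
        field_simp; ring
    _ ≤ 1 / 2 * (Real.exp (-((k - P) ^ 2 / P)) / (Real.exp 1 * Real.sqrt k)) := by
        gcongr

set_option maxHeartbeats 1000000 in
theorem statement5 :
    ∃ x₀ : ℝ, ∀ B : ℝ, 1 ≤ B → ∃ c₁ c₂ : ℝ, 0 < c₁ ∧ c₁ < c₂ ∧
      ∀ x y : ℝ, ∀ k : ℕ, x₀ ≤ x → 1 ≤ y → y ≤ x →
        2 * B ^ 2 ≤ LLog2 x - LLog2 y → 0 < k →
        |(k : ℝ) - (LLog2 x - LLog2 y)| ≤ B * Real.sqrt (LLog2 x - LLog2 y) →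
        c₁ / Real.sqrt (LLog2 x - LLog2 y)
            ≤ primeProd y x * ∑ᶠ n ∈ {n | n ∈ Sset y x ∧ omegaN n = k}, ((n : ℝ))⁻¹ ∧
          primeProd y x * ∑ᶠ n ∈ {n | n ∈ Sset y x ∧ omegaN n = k}, ((n : ℝ))⁻¹
            ≤ c₂ / Real.sqrt (LLog2 x - LLog2 y) := by
  obtain ⟨C, hC, hmert⟩ := aux_mertens_xy
  refine ⟨0, fun B hB => ?_⟩
  set L₀ : ℝ := 400 * B ^ 2 + 20 * C with hL₀
  set Y₀ : ℝ := 16 + Real.exp C + 8 * L₀ ^ 2 with hY₀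
  set X₀ : ℝ := Real.exp (Real.exp (L₀ + LLog2 Y₀)) with hX₀
  set K₀ : ℕ := ⌈2 * L₀⌉₊ with hK₀
  set d₁ : ℝ := Real.exp (-(2 * (B + C) ^ 2)) / (4 * Real.exp 1) with hd₁
  set d₂ : ℝ := Real.exp (-(L₀ + C)) * (1 / X₀) ^ K₀ with hd₂
  have hd₁p : 0 < d₁ := by positivity
  have hX₀p : 0 < X₀ := Real.exp_pos _
  have hX₀1 : 1 ≤ X₀ := Real.one_le_exp (Real.exp_pos _).le
  have hd₂p : 0 < d₂ := by positivity
  have hL₀p : 0 ≤ L₀ := by positivity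
  refine ⟨min d₁ d₂, min d₁ d₂ + 2 * Real.exp 1, lt_min hd₁p hd₂p,
    by linarith [Real.exp_pos 1], ?_⟩
  intro x y k _ hy hyx hBL hk hkL
  rw [aux_primeProd, aux_finsum]
  have hL2 : 2 ≤ LLog2 x - LLog2 y := by nlinarith
  obtain ⟨hm1, hm2⟩ := hmert x y hy hyx hL2
  have hT := aux_exists_T x y hy hL2 (by linarith) k
  have hxlog := log_eq_exp_LLog2 x (by linarith [LLog2_one_le y])
  set L := LLog2 x - LLog2 y with hLdef
  have hs1 : 1 ≤ Real.sqrt L := Real.one_le_sqrt.2 (by linarith)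
  have hss : Real.sqrt L * Real.sqrt L = L := Real.mul_self_sqrt (by linarith)
  have hBs : B ≤ 3 / 4 * Real.sqrt L := by
    rw [← sq_le_sq₀ (by linarith) (by linarith)]
    nlinarith
  have hBs' : B * Real.sqrt L ≤ 3 / 4 * L := by nlinarith
  have hkabs := abs_le.1 hkL
  have hk2 : (k:ℝ) ≤ 2 * L := by linarith [hkabs.2]
  have hk4 : L / 4 ≤ k := by linarith [hkabs.1]
  have hk0 : (0:ℝ) < k := by exact_mod_cast hk
  constructor
  · by_cases hLbig : L₀ ≤ L
    ·
      refine le_trans (div_le_div_of_nonneg_right (min_le_left _ _) (by positivity)) ?_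
      have hCL : 20 * C ≤ L := by nlinarith
      have h20 : 20 * B ≤ Real.sqrt L := by
        rw [← sq_le_sq₀ (by linarith) (by linarith)]
        nlinarith
      have hkk : (k:ℝ) ≤ 21 / 20 * L := by nlinarith [hkabs.2]
      have hPabs := abs_le.1 hm1
      have hPP : 19 / 20 * L ≤ ∑ p ∈ auxS y x, 1 / (p:ℝ) := by linarith [hPabs.1]
      refine aux_lower_main _ k hk B C L hC.le hL2 hk2 hkL (by linarith) hm1 ?_
      calc (k:ℝ) ^ 2 * ∑ p ∈ auxS y x, (1 / (p:ℝ)) ^ 2 ≤ (21 / 20 * L) ^ 2 * (3 / 4) := by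
            gcongr
            exact aux_Q_le y x
        _ ≤ (19 / 20 * L) ^ 2 := by nlinarith [sq_nonneg L]
        _ ≤ _ := pow_le_pow_left₀ (by linarith) hPP 2
    · push Not at hLbig
      by_cases hyb : Y₀ ≤ y
      · refine le_trans (div_le_div_of_nonneg_right (min_le_left _ _) (by positivity)) ?_
        have hexp := Real.exp_pos C
        have hy16 : 16 ≤ y := by nlinarith [sq_nonneg L₀]
        have hyC : C ≤ Real.log y := by
          rw [Real.le_log_iff_exp_le (by linarith)]
          nlinarith [sq_nonneg L₀]
        have hm3 := hm2 hy16
        have : C / Real.log y ≤ 1 := by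
          rw [div_le_one (by linarith)]; exact hyC
        have hPabs := abs_le.1 (hm3.trans this)
        refine aux_lower_main _ k hk B C L hC.le hL2 hk2 hkL
          (by linarith [hPabs.1]) hm1 ?_
        have hP1 : 1 ≤ ∑ p ∈ auxS y x, 1 / (p:ℝ) := by linarith [hPabs.1]
        calc (k:ℝ) ^ 2 * ∑ p ∈ auxS y x, (1 / (p:ℝ)) ^ 2 ≤ (2 * L₀) ^ 2 * (2 / y) := by
              gcongr
              · linarith
              · exact aux_Q_le' y x (by linarith)
          _ ≤ 1 := by
              rw [← mul_div_assoc, div_le_one (by linarith)]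
              nlinarith
          _ ≤ _ := one_le_pow₀ hP1
      · push Not at hyb
        have hmin : min d₁ d₂ / Real.sqrt L ≤ d₂ :=
          (div_le_self (lt_min hd₁p hd₂p).le hs1).trans (min_le_right _ _)
        refine hmin.trans ?_
        obtain ⟨T, hT⟩ := hT hk2
        have hxX : x ≤ X₀ := by
          rw [hX₀, ← Real.log_le_iff_le_exp (by linarith), hxlog]
          apply Real.exp_le_exp.2
          have := LLog2_mono (by linarith : 0 < y) hyb.le
          linarith
        have hE : (1 / X₀) ^ K₀ ≤ auxE (fun p => 1 / (p:ℝ)) (auxS y x) k := by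
          have h1 : ∏ p ∈ T, 1 / (p:ℝ) ≤ auxE (fun p => 1 / (p:ℝ)) (auxS y x) k := by
            unfold auxE
            exact Finset.single_le_sum (f := fun T : Finset ℕ => ∏ p ∈ T, 1 / (p:ℝ))
              (fun T _ => Finset.prod_nonneg fun p _ => one_div_nonneg.2 (Nat.cast_nonneg p)) hT
          refine le_trans ?_ h1
          rw [Finset.mem_powersetCard] at hT
          have h2 : ∏ _p ∈ T, (1 / X₀) ≤ ∏ p ∈ T, 1 / (p:ℝ) := by
            refine Finset.prod_le_prod (fun _ _ => one_div_nonneg.2 hX₀p.le) fun p hp => ?_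
            have := (mem_auxS y x p).1 (hT.1 hp)
            apply one_div_le_one_div_of_le
            · linarith [this.2.1]
            · linarith [this.2.2]
          rw [Finset.prod_const, hT.2] at h2
          refine le_trans ?_ h2
          apply pow_le_pow_of_le_one (by positivity)
          · rw [div_le_one hX₀p]; exact hX₀1
          · have h3 : (k:ℝ) ≤ K₀ := (by linarith : (k:ℝ) ≤ 2 * L₀).trans (Nat.le_ceil _)
            exact_mod_cast h3
        have hp := aux_prod_lower (auxS y x)
        have hPabs := abs_le.1 hm1
        rw [hd₂]
        apply mul_le_mul _ hE (by positivity) ((Real.exp_pos _).le.trans hp)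
        refine le_trans ?_ hp
        apply Real.exp_le_exp.2
        linarith [hPabs.2]
  · refine (aux_core_upper (auxS y x) k hk (aux_Q_le y x)).trans ?_
    have h1 : Real.sqrt L / 2 ≤ Real.sqrt k := by
      apply Real.le_sqrt_of_sq_le
      nlinarith
    have hsp : 0 < Real.sqrt L := by linarith
    calc Real.exp 1 / Real.sqrt k ≤ Real.exp 1 / (Real.sqrt L / 2) := by gcongr
      _ = 2 * Real.exp 1 / Real.sqrt L := by field_simp
      _ ≤ _ := by
        apply div_le_div_of_nonneg_right _ hsp.le
        linarith [lt_min hd₁p hd₂p]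
end
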